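/- arXiv:1802.10578 — 11 statements merged into one kernel-verified Lean document; each statement's English description precedes it below -/
import Mathlib

section
/- Let F = X_1^{m_1}+⋯+X_n^{m_n} in S = ℂ[X_1,…,X_n] with n ≥ 3 and each m_i ≥ 2. The S-module D_F = {D ∈ Der_ℂ(S) : D(F) ∈ F·S} is generated by the derivation E = (1/m_1)X_1 ∂/∂X_1 + ⋯ + (1/m_n)X_n ∂/∂X_n together with the derivations D_{ij} = m_i X_i^{m_i−1} ∂/∂X_j − m_j X_j^{m_j−1} ∂/∂X_i for i < j. -/
open MvPolynomial

noncomputable section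

/-- If every `f j` is a nonzerodivisor modulo the ideal generated by any finite set of the other
`f i`, then every syzygy of `f` is a combination of Koszul syzygies. -/
theorem mem_of_sum_mul_eq_zero_of_koszul_mem {ι R : Type*} [LinearOrder ι] [CommRing R]
    {f : ι → R}
    (hf : ∀ (s : Finset ι) (j : ι), j ∉ s → ∀ a, a * f j ∈ Ideal.span (f '' s) →
      a ∈ Ideal.span (f '' s))
    {N : Submodule R (ι → R)}
    (hN : ∀ i j, i < j → Pi.single j (f i) - Pi.single i (f j) ∈ N)
    (s : Finset ι) (a : ι → R) (ha : ∀ i ∉ s, a i = 0) (hsum : ∑ i ∈ s, a i * f i = 0) :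
    a ∈ N := by
  have hN' : ∀ i j, i ≠ j → Pi.single j (f i) - Pi.single i (f j) ∈ N := by
    intro i j hij
    rcases lt_or_gt_of_ne hij with h | h
    · exact hN i j h
    · rw [← neg_sub]
      exact N.neg_mem (hN j i h)
  induction s using Finset.induction_on generalizing a with
  | empty =>
    have : a = 0 := funext fun i => ha i (by simp)
    simp [this]
  | insert j s hj ih =>
    rw [Finset.sum_insert hj] at hsum
    have hmem : a j ∈ Ideal.span (f '' s) := by
      refine hf s j hj _ ?_
      rw [eq_neg_of_add_eq_zero_left hsum]
      exact neg_mem (sum_mem fun i hi => Ideal.mul_mem_left _ _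
        (Ideal.subset_span ⟨i, hi, rfl⟩))
    obtain ⟨b, hb⟩ := (Submodule.mem_span_image_finset_iff_exists_fun' R).1 hmem
    simp only [smul_eq_mul] at hb
    set c : ι → R := ∑ i ∈ s, b i • (Pi.single j (f i) - Pi.single i (f j)) with hc
    have hcN : c ∈ N := sum_mem fun i hi =>
      N.smul_mem _ (hN' i j (by rintro rfl; exact hj hi))
    have hcj : c j = a j := by
      rw [hc, Finset.sum_apply, ← hb]
      refine Finset.sum_congr rfl fun i hi => ?_
      have : j ≠ i := by rintro rfl; exact hj hi
      simp [this]
    have hcs : ∀ k ∈ s, c k = -(b k * f j) := by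
      intro k hk
      have : k ≠ j := by rintro rfl; exact hj hk
      simp [hc, Finset.sum_apply, this, Pi.single_apply, hk]
    have hco : ∀ k, k ≠ j → k ∉ s → c k = 0 := by
      intro k hkj hk
      simp [hc, Finset.sum_apply, hkj, Pi.single_apply, hk]
    rw [← sub_add_cancel a c]
    refine N.add_mem (ih _ ?_ ?_) hcN
    · intro k hk
      by_cases hkj : k = j
      · simp [hkj, hcj]
      · simp [hco k hkj hk, ha k (by simp [hkj, hk])]
    · rw [← hsum, ← hb, Finset.sum_mul, ← Finset.sum_add_distrib]
      refine Finset.sum_congr rfl fun k hk => ?_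
      rw [Pi.sub_apply, hcs k hk]
      ring

/-- A power of a variable is a nonzerodivisor modulo powers of other variables. -/
theorem mem_span_X_pow_of_mul_X_pow_mem {σ R : Type*} [CommRing R] (e : σ → ℕ) {s : Set σ}
    {j : σ} (hj : j ∉ s) {k : ℕ} {a : MvPolynomial σ R}
    (h : a * X j ^ k ∈ Ideal.span ((fun i => (X i : MvPolynomial σ R) ^ e i) '' s)) :
    a ∈ Ideal.span ((fun i => (X i : MvPolynomial σ R) ^ e i) '' s) := by
  have himage : (fun i => (X i : MvPolynomial σ R) ^ e i) '' s =
      (fun v => monomial v (1 : R)) '' ((fun i => Finsupp.single i (e i)) '' s) := by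
    simp only [Set.image_image, X_pow_eq_monomial]
  rw [himage, mem_ideal_span_monomial_image] at h ⊢
  intro v hv
  obtain ⟨_, ⟨i, hi, rfl⟩, hle⟩ := h (v + Finsupp.single j k) (by
    rw [mem_support_iff] at hv ⊢
    rwa [X_pow_eq_monomial, coeff_mul_monomial, mul_one])
  refine ⟨_, ⟨i, hi, rfl⟩, ?_⟩
  have hij : j ≠ i := by rintro rfl; exact hj hi
  simpa [Finsupp.single_le_iff, Finsupp.single_apply, hij] using hle

/-- `MvPolynomial.mkDerivation` as a map linear over the polynomial ring. -/
def mkDerivationLinearMap (σ R : Type*) [CommRing R] :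
    (σ → MvPolynomial σ R) →ₗ[MvPolynomial σ R]
      Derivation R (MvPolynomial σ R) (MvPolynomial σ R) where
  toFun := mkDerivation R
  map_add' f g := derivation_ext fun i => by simp
  map_smul' r f := derivation_ext fun i => by simp

theorem mkDerivationLinearMap_apply_X {σ R : Type*} [CommRing R]
    (D : Derivation R (MvPolynomial σ R) (MvPolynomial σ R)) :
    mkDerivationLinearMap σ R (fun i => D (X i)) = D :=
  derivation_ext fun i => mkDerivation_X R (fun i => D (X i)) i

theorem derivation_sum_X_pow {σ R : Type*} [Fintype σ] [CommRing R]
    (D : Derivation R (MvPolynomial σ R) (MvPolynomial σ R)) (m : σ → ℕ) :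
    D (∑ i, X i ^ m i) = ∑ i, D (X i) * ((m i : R) • X i ^ (m i - 1)) := by
  rw [map_sum]
  refine Finset.sum_congr rfl fun i _ => ?_
  rw [Derivation.leibniz_pow, Nat.cast_smul_eq_nsmul, smul_eq_mul, mul_smul_comm, mul_comm]

theorem mkDerivation_euler_sum_X_pow {σ K : Type*} [Fintype σ] [Field K] (m : σ → ℕ)
    (hm : ∀ i, (m i : K) ≠ 0) :
    mkDerivation K (fun i => ((m i : K))⁻¹ • (X i : MvPolynomial σ K)) (∑ i, X i ^ m i) =
      ∑ i, X i ^ m i := by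
  rw [derivation_sum_X_pow]
  refine Finset.sum_congr rfl fun i _ => ?_
  have hmi : m i ≠ 0 := fun h => hm i (by simp [h])
  rw [mkDerivation_X, smul_mul_smul_comm, inv_mul_cancel₀ (hm i), one_smul,
    mul_pow_sub_one hmi]

/-- For `F = X_1^{m_1}+⋯+X_n^{m_n}` in `S = ℂ[X_1,…,X_n]`,
the `S`-module `D_F = {D ∈ Der_ℂ(S) : D(F) ∈ F·S}` is generated by the Euler-type
derivation `E = Σ (1/m_i) X_i ∂/∂X_i` together with the derivations
`D_{ij} = m_i X_i^{m_i−1} ∂/∂X_j − m_j X_j^{m_j−1} ∂/∂X_i` for `i < j`. -/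
theorem fermat_DF_generators
    (n : ℕ) (hn : 3 ≤ n) (m : Fin n → ℕ) (hm : ∀ i, 2 ≤ m i) :
    {D : Derivation ℂ (MvPolynomial (Fin n) ℂ) (MvPolynomial (Fin n) ℂ) |
        D (∑ i, X i ^ m i) ∈
          Ideal.span {(∑ i, X i ^ m i : MvPolynomial (Fin n) ℂ)}} =
      ↑(Submodule.span (MvPolynomial (Fin n) ℂ)
        (insert (mkDerivation ℂ fun i => ((m i : ℂ))⁻¹ • (X i : MvPolynomial (Fin n) ℂ))
          {d | ∃ i j : Fin n, i < j ∧
            d = mkDerivation ℂ fun k =>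
              if k = i then -((m j : ℂ) • (X j : MvPolynomial (Fin n) ℂ) ^ (m j - 1))
              else if k = j then (m i : ℂ) • (X i : MvPolynomial (Fin n) ℂ) ^ (m i - 1)
              else 0})) := by
  have hm0 : ∀ i, (m i : ℂ) ≠ 0 := fun i => Nat.cast_ne_zero.2 (by have := hm i; omega)
  set f : Fin n → MvPolynomial (Fin n) ℂ := fun i => (m i : ℂ) • X i ^ (m i - 1) with hf
  set E := mkDerivation ℂ fun i => ((m i : ℂ))⁻¹ • (X i : MvPolynomial (Fin n) ℂ) with hE
  have hEF : E (∑ i, X i ^ m i) = ∑ i, X i ^ m i := mkDerivation_euler_sum_X_pow m hm0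
  have hkoszul : ∀ i j : Fin n, i < j →
      (fun k => if k = i then -f j else if k = j then f i else 0) =
        (Pi.single j (f i) - Pi.single i (f j) : Fin n → MvPolynomial (Fin n) ℂ) := by
    intro i j hij
    funext k
    by_cases hki : k = i
    · subst hki
      simp [hij.ne]
    · simp [hki, Pi.single_apply]
  have hspan : ∀ s : Set (Fin n), Ideal.span (f '' s) =
      Ideal.span ((fun i => (X i : MvPolynomial (Fin n) ℂ) ^ (m i - 1)) '' s) := by
    intro s
    refine le_antisymm (Ideal.span_le.2 ?_) (Ideal.span_le.2 ?_)
    · rintro _ ⟨i, hi, rfl⟩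
      exact Submodule.smul_of_tower_mem _ _ (Ideal.subset_span ⟨i, hi, rfl⟩)
    · rintro _ ⟨i, hi, rfl⟩
      have := Submodule.smul_of_tower_mem (Ideal.span (f '' s)) ((m i : ℂ)⁻¹)
        (Ideal.subset_span ⟨i, hi, rfl⟩)
      rwa [inv_smul_smul₀ (hm0 i)] at this
  ext D
  simp only [Set.mem_ofPred_eq, SetLike.mem_coe]
  constructor
  · intro hD
    obtain ⟨g, hg⟩ := Ideal.mem_span_singleton'.1 hD
    rw [← sub_add_cancel D (g • E)]
    refine add_mem ?_ (Submodule.smul_mem _ _ (Submodule.subset_span (Set.mem_insert _ _)))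
    have hzero : (D - g • E) (∑ i, X i ^ m i) = 0 := by
      rw [Derivation.sub_apply, Derivation.smul_apply, hEF, ← hg, smul_eq_mul, sub_self]
    rw [derivation_sum_X_pow] at hzero
    rw [← mkDerivationLinearMap_apply_X (D - g • E), ← Submodule.mem_comap]
    refine mem_of_sum_mul_eq_zero_of_koszul_mem (f := f) ?_ ?_ Finset.univ _
      (fun i hi => absurd (Finset.mem_univ i) hi) hzero
    · intro s j hj a ha
      rw [hspan] at ha ⊢
      refine mem_span_X_pow_of_mul_X_pow_mem (k := m j - 1) _ (Finset.mem_coe.not.2 hj) ?_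
      have := Submodule.smul_of_tower_mem _ ((m j : ℂ)⁻¹) ha
      rwa [← mul_smul_comm, inv_smul_smul₀ (hm0 j)] at this
    · intro i j hij
      refine Submodule.subset_span (Set.mem_insert_of_mem _ ⟨i, j, hij, ?_⟩)
      rw [← hkoszul i j hij]
      rfl
  · intro hD
    induction hD using Submodule.span_induction with
    | mem d hd =>
      rcases hd with rfl | ⟨i, j, hij, rfl⟩
      · rw [hEF]
        exact Ideal.mem_span_singleton_self _
      · have hzero : mkDerivation ℂ
            (Pi.single j (f i) - Pi.single i (f j) : Fin n → MvPolynomial (Fin n) ℂ)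
            (∑ i, X i ^ m i) = 0 := by
          rw [derivation_sum_X_pow]
          simp only [mkDerivation_X, Pi.sub_apply, sub_mul, Finset.sum_sub_distrib,
            Pi.single_apply, ite_mul, zero_mul, Finset.sum_ite_eq', Finset.mem_univ, if_true]
          exact sub_eq_zero.2 (mul_comm _ _)
        have := hkoszul i j hij
        simp only [hf] at this hzero
        rw [this, hzero]
        exact zero_mem _
    | zero => simp
    | add d₁ d₂ _ _ h₁ h₂ => exact add_mem h₁ h₂
    | smul r d _ h => exact Ideal.mul_mem_left _ r h
end
end

section
/- The B_n^m-module Der_ℂ(B_n^m) of ℂ-derivations of the Fermat ring is generated by the derivation ε defined by ε(x_i) = (1/m_i) x_i for all i, together with the derivations d_{ij} (i < j) defined by d_{ij}(x_i) = −m_j x_j^{m_j−1}, d_{ij}(x_j) = m_i x_i^{m_i−1}, and d_{ij}(x_k) = 0 for k ∉ {i,j}. -/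
open MvPolynomial

noncomputable section

/-- The Fermat ring `B_n^m = ℂ[X_1,…,X_n]/(X_1^{m_1}+⋯+X_n^{m_n})`. -/
abbrev FermatRing (n : ℕ) (m : Fin n → ℕ) : Type :=
  MvPolynomial (Fin n) ℂ ⧸
    Ideal.span {(∑ i, X i ^ m i : MvPolynomial (Fin n) ℂ)}

/-- The image `x_i` of the variable `X_i` in the Fermat ring. -/
def fx (n : ℕ) (m : Fin n → ℕ) (i : Fin n) : FermatRing n m :=
  Ideal.Quotient.mk _ (X i)

/-- If each member of a family is a nonzerodivisor modulo the ideal generated by any finite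
subfamily not containing it, then every syzygy of the family is a combination of Koszul
syzygies. -/
theorem mem_span_koszul {R ι : Type*} [CommRing R] [DecidableEq ι] (p : ι → R)
    (hp : ∀ (s : Finset ι) (j : ι), j ∉ s → ∀ a : R,
      p j * a ∈ Ideal.span (p '' s) → a ∈ Ideal.span (p '' s))
    (s : Finset ι) (a : ι → R) (has : ∀ i ∉ s, a i = 0) (ha : ∑ i ∈ s, a i * p i = 0) :
    a ∈ Submodule.span R
      {v : ι → R | ∃ i j, v = Pi.single j (p i) - Pi.single i (p j)} := by
  induction s using Finset.induction_on generalizing a with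
  | empty =>
    have : a = 0 := funext fun i => has i (Finset.notMem_empty i)
    exact this ▸ zero_mem _
  | insert j s hj ih =>
    rw [Finset.sum_insert hj] at ha
    have hmem : a j ∈ Ideal.span (p '' s) := by
      refine hp s j hj (a j) ?_
      rw [mul_comm, eq_neg_of_add_eq_zero_left ha]
      exact neg_mem (sum_mem fun i hi => Ideal.mul_mem_left _ _
        (Ideal.subset_span (Set.mem_image_of_mem p hi)))
    obtain ⟨b', hb'⟩ := (Submodule.mem_span_image_finset_iff_exists_fun R).1 hmem
    obtain ⟨b, hb⟩ : ∃ b : ι → R, ∑ i ∈ s, b i * p i = a j := by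
      refine ⟨fun i => if h : i ∈ s then b' ⟨i, h⟩ else 0, ?_⟩
      rw [← hb', ← Finset.sum_coe_sort s]
      simp
    set k : ι → R := ∑ i ∈ s, b i • (Pi.single j (p i) - Pi.single i (p j) : ι → R) with hk
    have hkmem : k ∈ Submodule.span R
        {v : ι → R | ∃ i j, v = Pi.single j (p i) - Pi.single i (p j)} :=
      sum_mem fun i _ => Submodule.smul_mem _ _ (Submodule.subset_span ⟨i, j, rfl⟩)
    have hkj : k j = a j := by
      rw [hk, Finset.sum_apply, ← hb]
      refine Finset.sum_congr rfl fun i hi => ?_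
      have : j ≠ i := fun h => hj (h ▸ hi)
      simp [this]
    have hks : ∀ l, l ≠ j → k l = if l ∈ s then -(b l * p j) else 0 := by
      intro l hl
      by_cases hls : l ∈ s <;> simp [hk, Finset.sum_apply, Pi.single_apply, hl, hls]
    rw [← sub_add_cancel a k]
    refine add_mem (ih (a - k) (fun i hi => ?_) ?_) hkmem
    · by_cases hij : i = j
      · simp [hij, hkj]
      · have := has i (by simp [hij, hi])
        simp [this, hks i hij, hi]
    · have : ∀ i ∈ s, (a - k) i * p i = a i * p i + (b i * p i) * p j := by
        intro i hi
        have hij : i ≠ j := fun h => hj (h ▸ hi)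
        simp only [Pi.sub_apply, hks i hij, hi, if_true]
        ring
      rw [Finset.sum_congr rfl this, Finset.sum_add_distrib, ← Finset.sum_mul, hb, add_comm]
      exact ha

/-- A power of a variable, up to a unit, is a nonzerodivisor modulo powers of other variables. -/
theorem mem_span_pow_X_of_mul_mem {K σ : Type*} [Field K] (c : σ → K) (hc : ∀ i, c i ≠ 0)
    (k : σ → ℕ) (s : Set σ) (j : σ) (hj : j ∉ s) (a : MvPolynomial σ K)
    (h : C (c j) * X j ^ k j * a ∈
      Ideal.span ((fun i => (C (c i) * X i ^ k i : MvPolynomial σ K)) '' s)) :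
    a ∈ Ideal.span ((fun i => (C (c i) * X i ^ k i : MvPolynomial σ K)) '' s) := by
  classical
  have hspan : Ideal.span ((fun i => (C (c i) * X i ^ k i : MvPolynomial σ K)) '' s) =
      Ideal.span ((fun t => monomial t (1 : K)) '' ((fun i => Finsupp.single i (k i)) '' s)) := by
    rw [Set.image_image]
    have hmon : ∀ i, (monomial (Finsupp.single i (k i)) (1 : K)) = X i ^ k i := fun i => by
      rw [X_pow_eq_monomial]
    simp only [hmon]
    refine le_antisymm (Ideal.span_le.2 ?_) (Ideal.span_le.2 ?_)
    · rintro _ ⟨i, hi, rfl⟩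
      exact Ideal.mul_mem_left _ _ (Ideal.subset_span ⟨i, hi, rfl⟩)
    · rintro _ ⟨i, hi, rfl⟩
      have : (X i ^ k i : MvPolynomial σ K) = C (c i)⁻¹ * (C (c i) * X i ^ k i) := by
        rw [← mul_assoc, ← C_mul, inv_mul_cancel₀ (hc i), C_1, one_mul]
      simp only [SetLike.mem_coe]
      rw [this]
      exact Ideal.mul_mem_left _ _ (Ideal.subset_span ⟨i, hi, rfl⟩)
  rw [hspan, mem_ideal_span_monomial_image] at h ⊢
  intro t ht
  have hcoeff : Finsupp.single j (k j) + t ∈ (C (c j) * X j ^ k j * a).support := by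
    rw [C_mul_X_pow_eq_monomial, mem_support_iff, coeff_monomial_mul]
    exact mul_ne_zero (hc j) (mem_support_iff.1 ht)
  obtain ⟨_, ⟨i, hi, rfl⟩, hle⟩ := h _ hcoeff
  refine ⟨_, ⟨i, hi, rfl⟩, ?_⟩
  have hij : j ≠ i := fun h => hj (h ▸ hi)
  rw [Finsupp.single_le_iff] at hle ⊢
  simpa [hij] using hle

theorem FermatRing.derivation_ext {n : ℕ} {m : Fin n → ℕ}
    {D₁ D₂ : Derivation ℂ (FermatRing n m) (FermatRing n m)}
    (h : ∀ i, D₁ (fx n m i) = D₂ (fx n m i)) : D₁ = D₂ := by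
  ext y
  obtain ⟨p, rfl⟩ := Ideal.Quotient.mk_surjective y
  induction p using MvPolynomial.induction_on with
  | C r =>
    exact (D₁.map_algebraMap r).trans (D₂.map_algebraMap r).symm
  | add p q hp hq => rw [map_add, map_add, map_add, hp, hq]
  | mul_X p i hp =>
    have hi : D₁ (Ideal.Quotient.mk _ (X i)) = D₂ (Ideal.Quotient.mk _ (X i)) := h i
    rw [map_mul, Derivation.leibniz, Derivation.leibniz, hp, hi]

theorem FermatRing.sum_fx_pow (n : ℕ) (m : Fin n → ℕ) : ∑ i, fx n m i ^ m i = 0 := by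
  have h : Ideal.Quotient.mk (Ideal.span {(∑ i, X i ^ m i : MvPolynomial (Fin n) ℂ)})
      (∑ i, X i ^ m i) = 0 :=
    Ideal.Quotient.eq_zero_iff_mem.2 (Ideal.mem_span_singleton_self _)
  simpa [fx] using h

/-- The `B_n^m`-module `Der_ℂ(B_n^m)` is generated by the
derivation `ε` (with `ε(x_i) = (1/m_i) x_i`) together with the derivations
`d_{ij}` for `i < j` (with `d_{ij}(x_i) = −m_j x_j^{m_j−1}`,
`d_{ij}(x_j) = m_i x_i^{m_i−1}`, `d_{ij}(x_k) = 0` otherwise). -/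
theorem fermat_der_generators
    (n : ℕ) (hn : 3 ≤ n) (m : Fin n → ℕ) (hm : ∀ i, 2 ≤ m i)
    (ε : Derivation ℂ (FermatRing n m) (FermatRing n m))
    (hε : ∀ i, ε (fx n m i) = ((m i : ℂ))⁻¹ • fx n m i)
    (dd : Fin n → Fin n → Derivation ℂ (FermatRing n m) (FermatRing n m))
    (hdd : ∀ i j : Fin n, i < j →
      dd i j (fx n m i) = -((m j : ℂ) • fx n m j ^ (m j - 1)) ∧
      dd i j (fx n m j) = (m i : ℂ) • fx n m i ^ (m i - 1) ∧
      ∀ k, k ≠ i → k ≠ j → dd i j (fx n m k) = 0) :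
    Submodule.span (FermatRing n m)
      (insert ε {d | ∃ i j : Fin n, i < j ∧ d = dd i j}) = ⊤ := by
  classical
  set N := Submodule.span (FermatRing n m)
    (insert ε {d | ∃ i j : Fin n, i < j ∧ d = dd i j}) with hN
  let q : MvPolynomial (Fin n) ℂ →+* FermatRing n m := Ideal.Quotient.mk _
  have hqC : ∀ (r : ℂ) (f : MvPolynomial (Fin n) ℂ), q (C r * f) = r • q f := fun r f => by
    rw [← smul_eq_C_mul]; rfl
  let g : Fin n → MvPolynomial (Fin n) ℂ := fun i => C (m i : ℂ) * X i ^ (m i - 1)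
  have hqg : ∀ i, q (g i) = (m i : ℂ) • fx n m i ^ (m i - 1) := fun i => by
    rw [hqC, map_pow]; rfl
  have hm0 : ∀ i, (m i : ℂ) ≠ 0 := fun i => Nat.cast_ne_zero.2 (by have := hm i; omega)
  have hlift : ∀ v ∈ Submodule.span (MvPolynomial (Fin n) ℂ)
      {v : Fin n → MvPolynomial (Fin n) ℂ |
        ∃ i j, v = Pi.single j (g i) - Pi.single i (g j)},
      ∃ d ∈ N, ∀ i, d (fx n m i) = q (v i) := by
    intro v hv
    induction hv using Submodule.span_induction with
    | mem v hv =>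
      have hlt : ∀ i j : Fin n, i < j → ∀ l, dd i j (fx n m l) =
          q ((Pi.single j (g i) - Pi.single i (g j) : Fin n → MvPolynomial (Fin n) ℂ) l) := by
        intro i j hij l
        obtain ⟨h1, h2, h3⟩ := hdd i j hij
        by_cases hli : l = i
        · subst hli
          simp [h1, hij.ne, hqg]
        · by_cases hlj : l = j
          · subst hlj
            simp [h2, hij.ne', hqg]
          · simp [h3 l hli hlj, hli, hlj]
      obtain ⟨i, j, rfl⟩ := hv
      rcases lt_trichotomy i j with hij | rfl | hij
      · exact ⟨dd i j, Submodule.subset_span (Or.inr ⟨i, j, hij, rfl⟩), hlt i j hij⟩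
      · exact ⟨0, zero_mem _, fun l => by simp⟩
      · refine ⟨(-1 : FermatRing n m) • dd j i,
          N.smul_mem _ (Submodule.subset_span (Or.inr ⟨j, i, hij, rfl⟩)), fun l => ?_⟩
        rw [Derivation.smul_apply, neg_one_smul, hlt j i hij, ← map_neg, ← Pi.neg_apply, neg_sub]
    | zero => exact ⟨0, zero_mem _, fun l => by simp⟩
    | add v w _ _ hv hw =>
      obtain ⟨d, hd, hdv⟩ := hv
      obtain ⟨e, he, hew⟩ := hw
      exact ⟨d + e, add_mem hd he, fun l => by simp [hdv, hew]⟩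
    | smul r v _ hv =>
      obtain ⟨d, hd, hdv⟩ := hv
      exact ⟨q r • d, N.smul_mem _ hd, fun l => by simp [hdv]⟩
  rw [eq_top_iff]
  rintro D -
  choose a ha using fun i => Ideal.Quotient.mk_surjective (D (fx n m i))
  replace ha : ∀ i, q (a i) = D (fx n m i) := ha
  have hzero : q (∑ i, a i * g i) = 0 := by
    have h := congrArg D (FermatRing.sum_fx_pow n m)
    rw [map_zero, map_sum] at h
    rw [map_sum, ← h]
    refine Finset.sum_congr rfl fun i _ => ?_
    rw [map_mul, ha, hqg, Derivation.leibniz_pow, smul_eq_mul, ← Nat.cast_smul_eq_nsmul ℂ,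
      mul_smul_comm, mul_comm]
  obtain ⟨b, hb⟩ := Ideal.mem_span_singleton.1 (Ideal.Quotient.eq_zero_iff_mem.1 hzero)
  have hEuler : ∀ i, C (m i : ℂ)⁻¹ * X i * g i = X i ^ m i := by
    intro i
    have h1 : (C (m i : ℂ)⁻¹ * C (m i : ℂ) : MvPolynomial (Fin n) ℂ) = 1 := by
      rw [← C_mul, inv_mul_cancel₀ (hm0 i), C_1]
    have h2 : (X i ^ m i : MvPolynomial (Fin n) ℂ) = X i * X i ^ (m i - 1) := by
      rw [← pow_succ', Nat.sub_add_cancel (by have := hm i; omega)]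
    rw [h2]
    linear_combination (X i * X i ^ (m i - 1)) * h1
  obtain ⟨d, hd, hdv⟩ := hlift (fun i => a i - b * (C (m i : ℂ)⁻¹ * X i)) <| by
    refine mem_span_koszul g (fun s j hj f hf => ?_) Finset.univ _ (by simp) ?_
    · exact mem_span_pow_X_of_mul_mem _ hm0 _ (s : Set (Fin n)) j (by simpa using hj) f hf
    · simp only [sub_mul, Finset.sum_sub_distrib, mul_assoc b, hEuler]
      rw [hb, ← Finset.mul_sum, mul_comm, sub_self]
  have hD : D = d + q b • ε := by
    refine FermatRing.derivation_ext fun i => ?_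
    have hX : q (X i) = fx n m i := rfl
    simp [hdv, hε, ha, hqC, hX]
  rw [hD]
  exact add_mem hd (N.smul_mem _ (Submodule.subset_span (Set.mem_insert _ _)))
end
end

section
/- Let d be a linear ℂ-derivation of the Fermat ring B_n^m with m = (m_1,…,m_n) and m_i ≥ 3 for all i. Then the associated matrix [d] = [a_{ij}] is diagonal, and there exists α ∈ ℂ such that a_{ii} = α/m_i for every i (and a_{ij} = 0 for i ≠ j). -/
open MvPolynomial

noncomputable section

/-- A linear derivation of the Fermat ring is tangent to the Fermat hypersurface: its associated
vector field annihilates the gradient of the defining equation at every point. -/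
lemma sum_mul_pow_mul_sum_eq_zero {n : ℕ} {m : Fin n → ℕ}
    {d : Derivation ℂ (FermatRing n m) (FermatRing n m)} {a : Matrix (Fin n) (Fin n) ℂ}
    (hd : ∀ i, d (fx n m i) = ∑ j, a i j • fx n m j)
    {p : Fin n → ℂ} (hp : ∑ i, p i ^ m i = 0) :
    ∑ i, (m i : ℂ) * p i ^ (m i - 1) * ∑ j, a i j * p j = 0 := by
  have hker : ∀ f ∈ Ideal.span {(∑ i, X i ^ m i : MvPolynomial (Fin n) ℂ)}, aeval p f = 0 := by
    intro f hf
    obtain ⟨g, rfl⟩ := Ideal.mem_span_singleton.mp hf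
    simp [hp]
  let φ : FermatRing n m →ₐ[ℂ] ℂ := Ideal.Quotient.liftₐ _ (aeval p) hker
  have hφ : ∀ i, φ (fx n m i) = p i := fun i => aeval_X p i
  have hrel : ∑ i, fx n m i ^ m i = 0 := by
    have h : Ideal.Quotient.mk (Ideal.span {(∑ i, X i ^ m i : MvPolynomial (Fin n) ℂ)})
        (∑ i, X i ^ m i) = 0 :=
      Ideal.Quotient.eq_zero_iff_mem.mpr (Ideal.mem_span_singleton_self _)
    simpa [fx] using h
  have h := congrArg (fun x => φ (d x)) hrel
  simpa [Derivation.leibniz_pow, hd, hφ, mul_assoc] using h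

/-- A quadratic that vanishes at `y`, `ω * y` and `ω ^ 2 * y` is zero. -/
lemma quadratic_coeff_eq_zero {K : Type*} [Field K] {y ω b c e : K}
    (hy : y ≠ 0) (hω : ω ≠ 0) (hω2 : ω ^ 2 ≠ 1)
    (h₀ : c * y ^ 2 + b * y = e) (h₁ : c * (ω * y) ^ 2 + b * (ω * y) = e)
    (h₂ : c * (ω ^ 2 * y) ^ 2 + b * (ω ^ 2 * y) = e) : c = 0 ∧ b = 0 := by
  have hω1 : ω - 1 ≠ 0 := fun h => hω2 (by linear_combination (ω + 1) * h)
  have hω2' : ω ^ 2 - 1 ≠ 0 := sub_ne_zero.mpr hω2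
  have e₁ : (ω + 1) * (c * y) + b = 0 := by
    have : (ω - 1) * y * ((ω + 1) * (c * y) + b) = 0 := by linear_combination h₁ - h₀
    simpa [hω1, hy] using this
  have e₂ : ω * (ω + 1) * (c * y) + b = 0 := by
    have : (ω - 1) * ω * y * (ω * (ω + 1) * (c * y) + b) = 0 := by linear_combination h₂ - h₁
    simpa [hω1, hω, hy] using this
  have hc : c = 0 := by
    have : (ω ^ 2 - 1) * y * c = 0 := by linear_combination e₂ - e₁
    simpa [hω2', hy] using this
  exact ⟨hc, by simpa [hc] using e₁⟩

/-- The tangency condition at the points `e_i + y e_j` of the Fermat hypersurface. -/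
lemma quadratic_relation {n : ℕ} {m : Fin n → ℕ} (hm : ∀ i, 2 ≤ m i)
    {d : Derivation ℂ (FermatRing n m) (FermatRing n m)} {a : Matrix (Fin n) (Fin n) ℂ}
    (hd : ∀ i, d (fx n m i) = ∑ j, a i j • fx n m j)
    {i j : Fin n} (hij : i ≠ j) {y : ℂ} (hy : y ^ m j = -1) :
    m i * a i j * y ^ 2 + (m i * a i i - m j * a j j) * y = m j * a j i := by
  let p : Fin n → ℂ := Pi.single i 1 + Pi.single j y
  have hpi : p i = 1 := by simp [p, hij]
  have hpj : p j = y := by simp [p, hij]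
  have hpk : ∀ k, k ≠ i ∧ k ≠ j → p k = 0 := fun k hk => by simp [p, hk.1, hk.2]
  have hm0 : ∀ k, m k ≠ 0 := fun k => by have := hm k; lia
  have hm1 : ∀ k, m k - 1 ≠ 0 := fun k => by have := hm k; lia
  have two : ∀ f : Fin n → ℂ, (∀ k, k ≠ i ∧ k ≠ j → f k = 0) → ∑ k, f k = f i + f j :=
    fun f hf => Finset.sum_eq_add i j hij (fun k _ => hf k) (by simp) (by simp)
  have hp : ∑ k, p k ^ m k = 0 := by
    rw [two _ fun k hk => by simp [hpk k hk, hm0 k], hpi, hpj, hy]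
    simp
  have hlin : ∀ k, ∑ l, a k l * p l = a k i + a k j * y := fun k => by
    rw [two _ fun l hl => by simp [hpk l hl], hpi, hpj, mul_one]
  have h := sum_mul_pow_mul_sum_eq_zero hd hp
  rw [two _ fun k hk => by simp [hpk k hk, hm1 k], hpi, hpj, hlin, hlin, one_pow] at h
  have hy' : y ^ (m j - 1) * y = -1 := by rw [pow_sub_one_mul (hm0 j), hy]
  linear_combination y * h - m j * (a j i + a j j * y) * hy'

/-- The two-variable case of the classification of linear derivations. -/
lemma offDiag_eq_zero_and_diag_eq {n : ℕ} {m : Fin n → ℕ} (hm : ∀ i, 3 ≤ m i)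
    {d : Derivation ℂ (FermatRing n m) (FermatRing n m)} {a : Matrix (Fin n) (Fin n) ℂ}
    (hd : ∀ i, d (fx n m i) = ∑ j, a i j • fx n m j) {i j : Fin n} (hij : i ≠ j) :
    a i j = 0 ∧ m i * a i i = m j * a j j := by
  have hi : (m i : ℂ) ≠ 0 := by have := hm i; norm_cast; lia
  have hj : m j ≠ 0 := by have := hm j; lia
  obtain ⟨y, hy⟩ := IsAlgClosed.exists_pow_nat_eq (-1 : ℂ) (Nat.pos_of_ne_zero hj)
  have hω := Complex.isPrimitiveRoot_exp (m j) hj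
  set ω := Complex.exp (2 * Real.pi * Complex.I / m j)
  have hy0 : y ≠ 0 := by
    rintro rfl
    simp [hj] at hy
  have hω2 : ω ^ 2 ≠ 1 := hω.pow_ne_one_of_pos_of_lt two_ne_zero (hm j)
  have rel : ∀ {z : ℂ}, z ^ m j = -1 → _ :=
    fun {_} hz => quadratic_relation (fun k => (Nat.le_succ 2).trans (hm k)) hd hij hz
  obtain ⟨hc, hb⟩ := quadratic_coeff_eq_zero hy0 (hω.ne_zero hj) hω2 (rel hy)
    (rel (by rw [mul_pow, hω.pow_eq_one, hy, one_mul]))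
    (rel (by rw [mul_pow, pow_right_comm, hω.pow_eq_one, hy, one_pow, one_mul]))
  exact ⟨(mul_eq_zero.mp hc).resolve_left hi, sub_eq_zero.mp hb⟩


/-- A linear ℂ-derivation of `B_n^m` with all `m_i ≥ 3` has a
diagonal associated matrix, with diagonal entries `α/m_i` for a common `α ∈ ℂ`. -/
theorem linear_derivation_diagonal
    (n : ℕ) (hn : 3 ≤ n) (m : Fin n → ℕ) (hm : ∀ i, 3 ≤ m i)
    (d : Derivation ℂ (FermatRing n m) (FermatRing n m))
    (a : Matrix (Fin n) (Fin n) ℂ)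
    (hd : ∀ i, d (fx n m i) = ∑ j, a i j • fx n m j) :
    (∀ i j, i ≠ j → a i j = 0) ∧ ∃ α : ℂ, ∀ i, a i i = α / (m i : ℂ) := by
  refine ⟨fun i j hij => (offDiag_eq_zero_and_diag_eq hm hd hij).1, ?_⟩
  let k : Fin n := ⟨0, by lia⟩
  refine ⟨m k * a k k, fun i => ?_⟩
  have hi : (m i : ℂ) ≠ 0 := by have := hm i; norm_cast; lia
  rw [eq_div_iff hi, mul_comm]
  rcases eq_or_ne i k with rfl | hik
  · rfl
  · exact (offDiag_eq_zero_and_diag_eq hm hd hik).2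
end
end

section
/- Let d be a ℂ-derivation of the Fermat ring B_n^m such that d(x_1) = a ∈ ℂ and, for each i with 1 < i ≤ n, d(x_i) ∈ ℂ[x_1,…,x_{i−1}] (the subring generated by x_1,…,x_{i−1}). Then d is the zero derivation. -/
open MvPolynomial

noncomputable section

namespace MvPolynomial

lemma degreeOf_eq_zero_of_mem_supported {σ R : Type*} [CommSemiring R] {s : Set σ} {i : σ}
    {p : MvPolynomial σ R} (hp : p ∈ supported R s) (hi : i ∉ s) : degreeOf i p = 0 := by
  by_contra h
  exact hi (mem_supported.1 hp (mem_vars_iff_degreeOf_ne_zero.2 h))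

variable {ι K : Type*} [LinearOrder ι] [Fintype ι] [Field K]

/-- If `f j` only involves the variables before `j` and vanishes for `j > i`, then all terms of
`∑ j, m j X_j ^ (m j - 1) f j` but the `i`-th only involve the variables before `i`. -/
lemma sum_erase_mem_supported_Iio (m : ι → ℕ) {f : ι → MvPolynomial ι K}
    (hf : ∀ i, f i ∈ supported K (Set.Iio i)) {i : ι} (hi : ∀ j, i < j → f j = 0) :
    ∑ j ∈ Finset.univ.erase i, (m j : MvPolynomial ι K) * X j ^ (m j - 1) * f j
      ∈ supported K (Set.Iio i) := by
  refine sum_mem fun j hj => ?_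
  rcases lt_or_gt_of_ne (Finset.ne_of_mem_erase hj) with h | h
  · exact mul_mem (mul_mem (natCast_mem _ _) (pow_mem (X_mem_supported.2 (Set.mem_Iio.2 h)) _))
      (supported_mono (Set.Iio_subset_Iio h.le) (hf j))
  · simp [hi j h]

lemma eq_zero_of_sum_mul_X_pow_eq_zero [CharZero K] {m : ι → ℕ} (hm : ∀ i, 2 ≤ m i)
    {f : ι → MvPolynomial ι K} (hf : ∀ i, f i ∈ supported K (Set.Iio i))
    (h : ∑ j, (m j : MvPolynomial ι K) * X j ^ (m j - 1) * f j = 0) (i : ι) : f i = 0 := by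
  induction i using WellFoundedGT.induction with
  | ind i ih =>
    by_contra hne
    have hi := hm i
    have hr := sum_erase_mem_supported_Iio m hf ih
    rw [← Finset.add_sum_erase _ _ (Finset.mem_univ i)] at h
    rw [← neg_eq_of_add_eq_zero_right h, neg_mem_iff] at hr
    have hdeg := degreeOf_eq_zero_of_mem_supported hr (Set.notMem_Iio.2 le_rfl)
    have hc : (m i : MvPolynomial ι K) ≠ 0 := Nat.cast_ne_zero.2 (by omega)
    rw [degreeOf_mul_eq (mul_ne_zero hc (pow_ne_zero _ (X_ne_zero i))) hne,
      degreeOf_mul_eq hc (pow_ne_zero _ (X_ne_zero i)), degreeOf_X_self_pow] at hdeg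
    omega

lemma sum_mul_X_pow_eq_zero_of_dvd [OrderTop ι] {m : ι → ℕ} (hm : ∀ i, 2 ≤ m i)
    {f : ι → MvPolynomial ι K} (hf : ∀ i, f i ∈ supported K (Set.Iio i))
    (h : ∑ j, X j ^ m j ∣ ∑ j, (m j : MvPolynomial ι K) * X j ^ (m j - 1) * f j) :
    ∑ j, (m j : MvPolynomial ι K) * X j ^ (m j - 1) * f j = 0 := by
  have htop := hm ⊤
  have hF : m ⊤ ≤ degreeOf ⊤ (∑ j, X j ^ m j : MvPolynomial ι K) := by
    have hr : ∑ j ∈ Finset.univ.erase ⊤, (X j ^ m j : MvPolynomial ι K) ∈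
        supported K (Set.Iio ⊤) := sum_mem fun j hj =>
      pow_mem (X_mem_supported.2 (Set.mem_Iio.2 (Ne.lt_top (Finset.ne_of_mem_erase hj)))) _
    have hdeg := degreeOf_eq_zero_of_mem_supported hr (Set.notMem_Iio.2 le_rfl)
    have hle := degreeOf_sub_le ⊤ (∑ j, X j ^ m j : MvPolynomial ι K)
      (∑ j ∈ Finset.univ.erase ⊤, (X j ^ m j : MvPolynomial ι K))
    rw [hdeg, ← Finset.add_sum_erase _ _ (Finset.mem_univ ⊤), add_sub_cancel_right,
      degreeOf_X_self_pow] at hle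
    rw [← Finset.add_sum_erase _ _ (Finset.mem_univ ⊤)]
    simpa using hle
  have hP : degreeOf ⊤ (∑ j, (m j : MvPolynomial ι K) * X j ^ (m j - 1) * f j) ≤ m ⊤ - 1 := by
    rw [← Finset.add_sum_erase _ _ (Finset.mem_univ ⊤)]
    refine (degreeOf_add_le _ _ _).trans (max_le ?_ ?_)
    · refine (degreeOf_mul_le _ _ _).trans ?_
      rw [degreeOf_eq_zero_of_mem_supported (hf ⊤) (Set.notMem_Iio.2 le_rfl), add_zero]
      refine (degreeOf_mul_le _ _ _).trans ?_
      rw [degreeOf_X_self_pow, ← map_natCast (C : K →+* MvPolynomial ι K), degreeOf_C, zero_add]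
    · rw [degreeOf_eq_zero_of_mem_supported (sum_erase_mem_supported_Iio m hf
        fun j hj => absurd hj not_top_lt) (Set.notMem_Iio.2 le_rfl)]
      exact Nat.zero_le _
  obtain ⟨q, hq⟩ := h
  by_contra hne
  rw [hq] at hP hne
  rw [degreeOf_mul_eq (left_ne_zero_of_mul hne) (right_ne_zero_of_mul hne)] at hP
  omega

end MvPolynomial

lemma exists_mem_supported_of_mem_adjoin_fx {n : ℕ} {m : Fin n → ℕ} {i : Fin n}
    {y : FermatRing n m}
    (hy : y ∈ Algebra.adjoin ℂ {y | ∃ j : Fin n, j < i ∧ y = fx n m j}) :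
    ∃ p ∈ supported ℂ (Set.Iio i), Ideal.Quotient.mk _ p = y := by
  have hs : {y | ∃ j : Fin n, j < i ∧ y = fx n m j} =
      Ideal.Quotient.mkₐ ℂ (Ideal.span {(∑ i, X i ^ m i : MvPolynomial (Fin n) ℂ)}) ''
        (X '' Set.Iio i) := by
    ext y
    simp [fx, eq_comm]
  rw [hs, ← AlgHom.map_adjoin] at hy
  exact hy

/-- If a ℂ-derivation `d` of `B_n^m` sends `x_1` to a constant
`a ∈ ℂ` and each `x_i` (for `i > 1`) into the subalgebra `ℂ[x_1,…,x_{i−1}]`,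
then `d` is the zero derivation. -/
theorem triangular_derivation_zero
    (n : ℕ) (hn : 3 ≤ n) (m : Fin n → ℕ) (hm : ∀ i, 2 ≤ m i)
    (d : Derivation ℂ (FermatRing n m) (FermatRing n m)) (a : ℂ)
    (h1 : d (fx n m ⟨0, by omega⟩) = algebraMap ℂ (FermatRing n m) a)
    (h2 : ∀ i : Fin n, (⟨0, by omega⟩ : Fin n) < i →
      d (fx n m i) ∈ Algebra.adjoin ℂ {y | ∃ j : Fin n, j < i ∧ y = fx n m j}) :
    d = 0 := by
  have hex : ∀ i, ∃ p ∈ supported ℂ (Set.Iio i), Ideal.Quotient.mk _ p = d (fx n m i) := by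
    intro i
    rcases (show (⟨0, by omega⟩ : Fin n) ≤ i from Nat.zero_le _).eq_or_lt with rfl | hi
    · exact ⟨C a, Subalgebra.algebraMap_mem _ a, h1.symm⟩
    · exact exists_mem_supported_of_mem_adjoin_fx (h2 i hi)
  choose f hf hfd using hex
  have hdvd : (∑ j, X j ^ m j : MvPolynomial (Fin n) ℂ) ∣
      ∑ j, (m j : MvPolynomial (Fin n) ℂ) * X j ^ (m j - 1) * f j := by
    rw [← Ideal.mem_span_singleton, ← Ideal.Quotient.eq_zero_iff_mem]
    have hF : (∑ j, fx n m j ^ m j : FermatRing n m) = 0 := by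
      simp only [fx, ← map_pow, ← map_sum]
      exact Ideal.Quotient.eq_zero_iff_mem.2 (Ideal.mem_span_singleton_self _)
    have hd := congrArg d hF
    rw [map_zero, map_sum] at hd
    rw [← hd, map_sum]
    refine Finset.sum_congr rfl fun j _ => ?_
    rw [Derivation.leibniz_pow, ← hfd]
    simp [fx, mul_assoc]
  have : NeZero n := ⟨by omega⟩
  have hf0 := eq_zero_of_sum_mul_X_pow_eq_zero hm hf (sum_mul_X_pow_eq_zero_of_dvd hm hf hdvd)
  have hcomp : d.compAlgebraMap (MvPolynomial (Fin n) ℂ) = 0 :=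
    derivation_ext fun i => by
      simpa [hf0 i, fx] using (hfd i).symm
  ext y
  obtain ⟨p, rfl⟩ := Ideal.Quotient.mk_surjective y
  exact DFunLike.congr_fun hcomp p
end
end

section
/- Let d be a linear ℂ-derivation of the Fermat ring B_n^m with associated matrix [a_{ij}]. Then d is locally nilpotent if and only if the matrix [a_{ij}] is nilpotent. -/
open MvPolynomial

noncomputable section

/-- If `d` kills `f` and `g` after `s` and `t` steps, it kills `f * g` after `s + t` steps. -/
theorem Derivation.iterate_add_mul_eq_zero {R A : Type*} [CommRing R] [CommRing A] [Algebra R A]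
    (d : Derivation R A A) (s t : ℕ) (f g : A) (hf : d^[s] f = 0) (hg : d^[t] g = 0) :
    d^[s + t] (f * g) = 0 := by
  induction s generalizing f t g with
  | zero =>
    rw [Function.iterate_zero_apply] at hf
    rw [hf, zero_mul, iterate_map_zero]
  | succ s ihs =>
    induction t generalizing g with
    | zero =>
      rw [Function.iterate_zero_apply] at hg
      rw [hg, mul_zero, iterate_map_zero]
    | succ t iht =>
      have hleft : d^[s + 1 + t] (f * d g) = 0 := iht _ hg
      have hright : d^[s + 1 + t] (d f * g) = 0 := by
        rw [show s + 1 + t = s + (t + 1) by ring]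
        exact ihs _ _ _ hf hg
      rw [← add_assoc, Function.iterate_succ_apply, d.leibniz, iterate_map_add,
        smul_eq_mul, smul_eq_mul, mul_comm g, hleft, hright, add_zero]

/-- Once an iterate of `d` kills an element, so do all later iterates. -/
theorem Derivation.iterate_eq_zero_of_le {R A : Type*} [CommRing R] [CommRing A] [Algebra R A]
    (d : Derivation R A A) {s t : ℕ} (hst : s ≤ t) {f : A} (hf : d^[s] f = 0) :
    d^[t] f = 0 := by
  obtain ⟨k, rfl⟩ := Nat.exists_eq_add_of_le' hst
  rw [Function.iterate_add_apply, hf, iterate_map_zero]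

/-- If every exponent is at least `2`, the elements `x_i` are linearly independent. -/
theorem linearIndependent_fx (n : ℕ) (m : Fin n → ℕ) (hm : ∀ i, 2 ≤ m i) :
    LinearIndependent ℂ (fx n m) := by
  rw [Fintype.linearIndependent_iff]
  intro c hc k
  let φ : MvPolynomial (Fin n) ℂ →ₐ[ℂ] DualNumber ℂ :=
    aeval fun i => if i = k then DualNumber.eps else 0
  have hφ : φ (∑ i, X i ^ m i) = 0 := by
    rw [map_sum]
    refine Finset.sum_eq_zero fun i _ => ?_
    rw [map_pow, aeval_X]
    refine pow_eq_zero_of_le (hm i) ?_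
    split_ifs <;> simp [pow_two]
  have hmem : ∑ i, c i • (X i : MvPolynomial (Fin n) ℂ) ∈
      Ideal.span {(∑ i, X i ^ m i : MvPolynomial (Fin n) ℂ)} := by
    rw [← Ideal.Quotient.eq_zero_iff_mem, ← hc, map_sum]
    rfl
  obtain ⟨q, hq⟩ := Ideal.mem_span_singleton.mp hmem
  have hzero : ∑ i, c i • φ (X i) = 0 := by
    simpa only [map_sum, map_smul, map_mul, hφ, zero_mul] using congrArg φ hq
  simpa [φ, aeval_X] using congrArg TrivSqZeroExt.snd hzero

/-- The iterates of a linear derivation act on the `x_i` through the powers of its matrix. -/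
theorem iterate_fx (n : ℕ) (m : Fin n → ℕ)
    (d : Derivation ℂ (FermatRing n m) (FermatRing n m)) (a : Matrix (Fin n) (Fin n) ℂ)
    (hd : ∀ i, d (fx n m i) = ∑ j, a i j • fx n m j) (s : ℕ) (i : Fin n) :
    d^[s] (fx n m i) = ∑ j, (a ^ s) i j • fx n m j := by
  induction s with
  | zero => simp [Matrix.one_apply]
  | succ s ih =>
    rw [Function.iterate_succ_apply', ih, map_sum]
    simp_rw [d.map_smul, hd, pow_succ, Matrix.mul_apply, Finset.smul_sum, Finset.sum_smul,
      smul_smul]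
    exact Finset.sum_comm

/-- A linear ℂ-derivation of `B_n^m` is locally nilpotent if and
only if its associated matrix is nilpotent. -/
theorem linear_derivation_locally_nilpotent_iff
    (n : ℕ) (hn : 3 ≤ n) (m : Fin n → ℕ) (hm : ∀ i, 2 ≤ m i)
    (d : Derivation ℂ (FermatRing n m) (FermatRing n m))
    (a : Matrix (Fin n) (Fin n) ℂ)
    (hd : ∀ i, d (fx n m i) = ∑ j, a i j • fx n m j) :
    (∀ r : FermatRing n m, ∃ s : ℕ, (⇑d)^[s] r = 0) ↔ IsNilpotent a := by
  constructor
  · intro h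
    choose s hs using fun i => h (fx n m i)
    refine ⟨∑ i, s i, ?_⟩
    ext i j
    have hle : s i ≤ ∑ i, s i := Finset.single_le_sum_of_canonicallyOrdered (Finset.mem_univ i)
    have hzero := d.iterate_eq_zero_of_le hle (hs i)
    rw [iterate_fx n m d a hd] at hzero
    exact Fintype.linearIndependent_iff.mp (linearIndependent_fx n m hm) _ hzero j
  · rintro ⟨N, hN⟩ r
    obtain ⟨p, rfl⟩ := Ideal.Quotient.mk_surjective r
    induction p using MvPolynomial.induction_on with
    | C c => exact ⟨1, d.map_algebraMap c⟩
    | add p q hp hq =>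
      obtain ⟨s, hs⟩ := hp
      obtain ⟨t, ht⟩ := hq
      refine ⟨max s t, ?_⟩
      rw [map_add, iterate_map_add, d.iterate_eq_zero_of_le (le_max_left s t) hs,
        d.iterate_eq_zero_of_le (le_max_right s t) ht, add_zero]
    | mul_X p i hp =>
      obtain ⟨s, hs⟩ := hp
      refine ⟨s + N, ?_⟩
      rw [map_mul]
      refine d.iterate_add_mul_eq_zero s N _ _ hs ?_
      refine (iterate_fx n m d a hd N i).trans ?_
      simp only [hN, Matrix.zero_apply, zero_smul, Finset.sum_const_zero]
end
end

section
/- If d is a linear locally nilpotent ℂ-derivation of the Fermat ring B_n^m with m = (m_1,…,m_n) and m_i ≥ 3 for all i, then d is the zero derivation. -/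
open MvPolynomial

noncomputable section

/-- Multiples of the Fermat polynomial have no terms outside the ideal `(X_1^{m_1},…,X_n^{m_n})`. -/
theorem coeff_eq_zero_of_mem_span_fermat {n : ℕ} {m : Fin n → ℕ} {p : MvPolynomial (Fin n) ℂ}
    (hp : p ∈ Ideal.span {(∑ i, X i ^ m i : MvPolynomial (Fin n) ℂ)})
    {e : Fin n →₀ ℕ} (he : ∀ k, e k < m k) : coeff e p = 0 := by
  obtain ⟨q, rfl⟩ := Ideal.mem_span_singleton.mp hp
  rw [Finset.sum_mul, coeff_sum]
  refine Finset.sum_eq_zero fun k _ => ?_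
  rw [X_pow_eq_monomial, coeff_monomial_mul', if_neg]
  intro hle
  have := hle k
  rw [Finsupp.single_eq_same] at this
  exact absurd this (not_le.mpr (he k))

theorem fx_ne_zero (n : ℕ) (m : Fin n → ℕ) (hm : ∀ i, 2 ≤ m i) (i : Fin n) : fx n m i ≠ 0 := by
  intro h
  have hc := coeff_eq_zero_of_mem_span_fermat (Ideal.Quotient.eq_zero_iff_mem.mp h)
    (e := Finsupp.single i 1) fun k => by
      have := hm k
      rw [Finsupp.single_apply]
      split_ifs <;> omega
  simp at hc

/-- For `r ≥ 2`, the monomial `X_i^r X_j` with `i ≠ j` determines `i` and `j`. -/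
theorem single_add_single_one_inj {σ : Type*} {r : σ → ℕ} (hr : ∀ i, 2 ≤ r i) {i j k l : σ}
    (hij : i ≠ j)
    (h : Finsupp.single k (r k) + Finsupp.single l 1
      = Finsupp.single i (r i) + Finsupp.single j 1) : k = i ∧ l = j := by
  classical
  have hk : k = i := by
    by_contra hki
    have h1 := DFunLike.congr_fun h i
    have h2 := hr i
    simp only [Finsupp.add_apply, Finsupp.single_apply, if_neg hki, if_neg hij.symm, if_true] at h1
    split_ifs at h1 <;> omega
  subst hk
  exact ⟨rfl, Finsupp.single_left_injective one_ne_zero (add_left_cancel h)⟩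

/-- The matrix of a linear derivation of the Fermat ring is diagonal. -/
theorem linear_coeff_eq_zero (n : ℕ) (m : Fin n → ℕ) (hm : ∀ i, 3 ≤ m i)
    (d : Derivation ℂ (FermatRing n m) (FermatRing n m))
    (a : Matrix (Fin n) (Fin n) ℂ)
    (hd : ∀ i, d (fx n m i) = ∑ j, a i j • fx n m j) {i j : Fin n} (hij : i ≠ j) :
    a i j = 0 := by
  have hrel : ∑ k, fx n m k ^ m k = 0 := by
    have h : Ideal.Quotient.mk (Ideal.span {(∑ i, X i ^ m i : MvPolynomial (Fin n) ℂ)})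
        (∑ i, X i ^ m i) = 0 :=
      Ideal.Quotient.eq_zero_iff_mem.mpr (Ideal.mem_span_singleton_self _)
    rw [map_sum] at h
    simpa only [map_pow, fx] using h
  have hmem : (∑ k, ∑ l, monomial (Finsupp.single k (m k - 1) + Finsupp.single l 1)
      ((m k : ℂ) * a k l)) ∈ Ideal.span {(∑ i, X i ^ m i : MvPolynomial (Fin n) ℂ)} := by
    rw [← Ideal.Quotient.eq_zero_iff_mem, ← map_zero d, ← hrel, map_sum, map_sum]
    refine Finset.sum_congr rfl fun k _ => ?_
    rw [d.leibniz_pow, hd, map_sum, Finset.smul_sum, Finset.smul_sum]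
    refine Finset.sum_congr rfl fun l _ => ?_
    have hmon : (monomial (Finsupp.single k (m k - 1) + Finsupp.single l 1) ((m k : ℂ) * a k l) :
        MvPolynomial (Fin n) ℂ) = m k • (X k ^ (m k - 1) * (a k l • X l)) := by
      rw [X_pow_eq_monomial, ← pow_one (X l), X_pow_eq_monomial, smul_monomial,
        smul_eq_mul, monomial_mul,
        ← Nat.cast_smul_eq_nsmul ℂ, smul_monomial]
      simp
    rw [hmon]
    rfl
  have hc := coeff_eq_zero_of_mem_span_fermat hmem
    (e := Finsupp.single i (m i - 1) + Finsupp.single j 1) fun k => by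
      have := hm k
      rw [Finsupp.add_apply, Finsupp.single_apply, Finsupp.single_apply]
      split_ifs with h1 h2
      · exact absurd (h1.trans h2.symm) hij
      all_goals subst_vars; omega
  have hinj {k l : Fin n} := single_add_single_one_inj (r := fun i => m i - 1)
    (fun i => by have := hm i; omega) (k := k) (l := l) hij
  simp only [coeff_sum, coeff_monomial] at hc
  rw [Finset.sum_eq_single i, Finset.sum_eq_single j, if_pos rfl] at hc
  · refine (mul_eq_zero.mp hc).resolve_left (Nat.cast_ne_zero.mpr ?_)
    have := hm i
    omega
  · exact fun l _ hl => if_neg fun h => hl (hinj h).2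
  · simp
  · exact fun k _ hk => Finset.sum_eq_zero fun l _ => if_neg fun h => hk (hinj h).1
  · simp

/-- A linear locally nilpotent ℂ-derivation of `B_n^m` with all
`m_i ≥ 3` is the zero derivation. -/
theorem linear_lnd_is_zero
    (n : ℕ) (hn : 3 ≤ n) (m : Fin n → ℕ) (hm : ∀ i, 3 ≤ m i)
    (d : Derivation ℂ (FermatRing n m) (FermatRing n m))
    (a : Matrix (Fin n) (Fin n) ℂ)
    (hd : ∀ i, d (fx n m i) = ∑ j, a i j • fx n m j)
    (hln : ∀ r : FermatRing n m, ∃ s : ℕ, (⇑d)^[s] r = 0) :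
    d = 0 := by
  have hoff : ∀ i j, i ≠ j → a i j = 0 := fun i j hij =>
    linear_coeff_eq_zero n m hm d a hd hij
  have hdiag : ∀ i, d (fx n m i) = a i i • fx n m i := fun i => by
    rw [hd, Finset.sum_eq_single i (fun j _ hj => by rw [hoff i j hj.symm, zero_smul])
      (fun h => absurd (Finset.mem_univ i) h)]
  have hzero : ∀ i, d (fx n m i) = 0 := fun i => by
    have hiter : ∀ s : ℕ, (⇑d)^[s] (fx n m i) = a i i ^ s • fx n m i := fun s => by
      induction s with
      | zero => simp
      | succ s ih =>
        rw [Function.iterate_succ_apply', ih, d.map_smul, hdiag, smul_smul, pow_succ]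
    obtain ⟨s, hs⟩ := hln (fx n m i)
    rw [hiter, smul_eq_zero_iff_left (fx_ne_zero n m (fun k => by have := hm k; omega) i)] at hs
    rw [hdiag, eq_zero_of_pow_eq_zero hs, zero_smul]
  ext r
  obtain ⟨p, rfl⟩ := Ideal.Quotient.mk_surjective r
  induction p using MvPolynomial.induction_on with
  | C c => exact d.map_algebraMap c
  | add p q hp hq => simpa using congrArg₂ (· + ·) hp hq
  | mul_X p i hp =>
    have hi : d (Ideal.Quotient.mk _ (X i)) = 0 := hzero i
    rw [Derivation.zero_apply] at hp ⊢
    rw [map_mul, d.leibniz, hp, hi, smul_zero, smul_zero, add_zero]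
end
end

section
/- Let d be a nonzero linear ℂ-derivation of the Fermat ring B_n^m with m = (m_1,…,m_n) and m_i ≥ 3 for all i. Then the ring of constants of d is trivial: ker(d) = ℂ. -/
open MvPolynomial

noncomputable section

/-- The exponent vector of `X_i ^ (k - 1) * X_j` determines `i` and `j` when `k ≥ 3` throughout. -/
theorem single_pred_add_single_injective {n : ℕ} {m : Fin n → ℕ} (hm : ∀ i, 3 ≤ m i)
    {i j k l : Fin n}
    (h : Finsupp.single k (m k - 1) + Finsupp.single l 1 =
      Finsupp.single i (m i - 1) + Finsupp.single j 1) : k = i ∧ l = j := by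
  have hki : k = i := by
    by_contra hne
    have h1 := DFunLike.congr_fun h k
    have h2 := hm k
    simp only [Finsupp.add_apply, Finsupp.single_apply, if_true, if_neg (Ne.symm hne)] at h1
    split_ifs at h1 <;> omega
  subst hki
  exact ⟨rfl, Finsupp.single_left_injective one_ne_zero (add_left_cancel h)⟩

/-- The lift of a linear derivation with matrix `a` to the polynomial ring. -/
def linearLift {n : ℕ} (a : Matrix (Fin n) (Fin n) ℂ) :
    Derivation ℂ (MvPolynomial (Fin n) ℂ) (MvPolynomial (Fin n) ℂ) :=
  mkDerivation ℂ fun i => ∑ j, a i j • X j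

theorem mk_linearLift {n : ℕ} {m : Fin n → ℕ}
    (d : Derivation ℂ (FermatRing n m) (FermatRing n m)) (a : Matrix (Fin n) (Fin n) ℂ)
    (hd : ∀ i, d (fx n m i) = ∑ j, a i j • fx n m j) (p : MvPolynomial (Fin n) ℂ) :
    (Ideal.Quotient.mk _ (linearLift a p) : FermatRing n m) = d (Ideal.Quotient.mk _ p) := by
  induction p using MvPolynomial.induction_on with
  | C r =>
    have h1 : linearLift a (C r) = 0 := (linearLift a).map_algebraMap r
    have h2 : d (Ideal.Quotient.mk _ (C r)) = 0 := d.map_algebraMap r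
    rw [h1, h2, map_zero]
  | add p q hp hq => simp only [map_add, hp, hq]
  | mul_X p i hp =>
    have hX : (Ideal.Quotient.mk _ (linearLift a (X i)) : FermatRing n m) =
        d (Ideal.Quotient.mk _ (X i)) := by
      refine Eq.trans ?_ (hd i).symm
      rw [linearLift, mkDerivation_X, map_sum]
      rfl
    rw [Derivation.leibniz, map_mul, Derivation.leibniz, ← hX, ← hp]
    simp only [smul_eq_mul, map_add, map_mul]

theorem linearLift_fermat {n : ℕ} (m : Fin n → ℕ) (a : Matrix (Fin n) (Fin n) ℂ) :
    linearLift a (∑ i, X i ^ m i) =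
      ∑ i, ∑ j, monomial (Finsupp.single i (m i - 1) + Finsupp.single j 1) (m i * a i j) := by
  rw [map_sum]
  refine Finset.sum_congr rfl fun i _ => ?_
  rw [Derivation.leibniz_pow, linearLift, mkDerivation_X, Finset.smul_sum, Finset.smul_sum]
  refine Finset.sum_congr rfl fun j _ => ?_
  rw [X_pow_eq_monomial, X, smul_eq_mul, smul_monomial, monomial_mul, ← Nat.cast_smul_eq_nsmul ℂ,
    smul_monomial]
  simp

theorem fermat_eq_sum_monomial {n : ℕ} {m : Fin n → ℕ} (hm : ∀ i, 3 ≤ m i) :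
    (∑ i, X i ^ m i : MvPolynomial (Fin n) ℂ) =
      ∑ i, ∑ j, monomial (Finsupp.single i (m i - 1) + Finsupp.single j 1)
        (if i = j then 1 else 0) := by
  refine Finset.sum_congr rfl fun i _ => ?_
  rw [Finset.sum_eq_single i, if_pos rfl, ← Finsupp.single_add, X_pow_eq_monomial,
    Nat.sub_add_cancel (by linarith [hm i])]
  · intro j _ hj
    rw [if_neg (Ne.symm hj), map_zero]
  · simp

theorem coeff_sum_monomial_single {n : ℕ} {m : Fin n → ℕ} (hm : ∀ i, 3 ≤ m i)
    (b : Fin n → Fin n → ℂ) (i j : Fin n) :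
    coeff (Finsupp.single i (m i - 1) + Finsupp.single j 1)
      (∑ k, ∑ l, monomial (Finsupp.single k (m k - 1) + Finsupp.single l 1) (b k l)) = b i j := by
  simp only [coeff_sum, coeff_monomial]
  rw [Finset.sum_eq_single i, Finset.sum_eq_single j, if_pos rfl]
  · intro l _ hl
    exact if_neg fun h => hl (single_pred_add_single_injective hm h).2
  · simp
  · intro k _ hk
    exact Finset.sum_eq_zero fun l _ =>
      if_neg fun h => hk (single_pred_add_single_injective hm h).1
  · simp

/-- A linear derivation that preserves the Fermat ideal is diagonal, with eigenvalues
inversely proportional to the exponents. -/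
theorem exists_diagonal_of_dvd_linearLift {n : ℕ} {m : Fin n → ℕ} (hm : ∀ i, 3 ≤ m i)
    (a : Matrix (Fin n) (Fin n) ℂ)
    (h : (∑ i, X i ^ m i : MvPolynomial (Fin n) ℂ) ∣ linearLift a (∑ i, X i ^ m i)) :
    ∃ c : ℂ, ∀ i j, m i * a i j = if i = j then c else 0 := by
  obtain ⟨g, hg⟩ := h
  set F : MvPolynomial (Fin n) ℂ := ∑ i, X i ^ m i with hF
  have hmF : ∀ i, m i ≤ F.totalDegree := by
    intro i
    have hc := coeff_sum_monomial_single hm (fun k l => if k = l then 1 else 0) i i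
    rw [← fermat_eq_sum_monomial hm, ← hF, if_pos rfl, ← Finsupp.single_add,
      Nat.sub_add_cancel (by linarith [hm i])] at hc
    have := le_totalDegree (p := F) (s := Finsupp.single i (m i))
      (mem_support_iff.2 (by rw [hc]; exact one_ne_zero))
    simpa using this
  have hdeg : (linearLift a F).totalDegree ≤ F.totalDegree := by
    rw [linearLift_fermat m a]
    refine totalDegree_finsetSum_le fun i _ => totalDegree_finsetSum_le fun j _ => ?_
    refine (totalDegree_monomial_le _ _).trans (le_trans ?_ (hmF i))
    rw [Finsupp.sum_add_index' (by simp) (by simp)]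
    have := hm i
    rw [Finsupp.sum_single_index rfl, Finsupp.sum_single_index rfl]
    simp only [id]
    omega
  obtain ⟨c, hgc⟩ : ∃ c, F * g = F * C c := by
    by_cases hz : F * g = 0
    · exact ⟨0, by rw [hz, map_zero, mul_zero]⟩
    · rw [hg, totalDegree_mul_of_isDomain (left_ne_zero_of_mul hz) (right_ne_zero_of_mul hz)] at hdeg
      exact ⟨_, congrArg (F * ·) (totalDegree_eq_zero_iff_eq_C.1 (by omega))⟩
  refine ⟨c, fun i j => ?_⟩
  have hc := coeff_sum_monomial_single hm (fun i j => m i * a i j) i j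
  rw [← linearLift_fermat m a, ← hF, hg, hgc, mul_comm, coeff_C_mul, hF, fermat_eq_sum_monomial hm,
    coeff_sum_monomial_single hm] at hc
  rw [← hc]
  simp

/-- The weighted degree of an exponent vector for which `X_i` has weight `1 / m_i`. -/
def fermatWeight {n : ℕ} (m : Fin n → ℕ) : (Fin n →₀ ℕ) →+ ℂ :=
  Finsupp.liftAddHom fun i => (AddMonoidHom.mulRight ((m i : ℂ)⁻¹)).comp (Nat.castAddMonoidHom ℂ)

theorem fermatWeight_single {n : ℕ} (m : Fin n → ℕ) (i : Fin n) (k : ℕ) :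
    fermatWeight m (Finsupp.single i k) = k * (m i : ℂ)⁻¹ := by
  simp [fermatWeight]

theorem fermatWeight_eq_zero {n : ℕ} {m : Fin n → ℕ} (hm : ∀ i, m i ≠ 0) {s : Fin n →₀ ℕ}
    (h : fermatWeight m s = 0) : s = 0 := by
  have h1 : fermatWeight m s = ((∑ i, s i * (m i : ℝ)⁻¹ : ℝ) : ℂ) := by
    simp [fermatWeight, Finsupp.sum_fintype]
  rw [h1, Complex.ofReal_eq_zero, Finset.sum_eq_zero_iff_of_nonneg fun i _ => by positivity] at h
  ext i
  have := h i (Finset.mem_univ i)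
  simpa [hm i] using this

/-- Division of each monomial by its weight; the constant term is sent to zero. -/
def weightInv {n : ℕ} (m : Fin n → ℕ) : MvPolynomial (Fin n) ℂ →ₗ[ℂ] MvPolynomial (Fin n) ℂ :=
  (basisMonomials (Fin n) ℂ).constr ℂ fun s => monomial s (fermatWeight m s)⁻¹

theorem weightInv_monomial {n : ℕ} (m : Fin n → ℕ) (s : Fin n →₀ ℕ) (r : ℂ) :
    weightInv m (monomial s r) = (fermatWeight m s)⁻¹ • monomial s r := by
  have h := (basisMonomials (Fin n) ℂ).constr_basis ℂ
    (fun s => (monomial s (fermatWeight m s)⁻¹ : MvPolynomial (Fin n) ℂ)) s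
  rw [coe_basisMonomials] at h
  have hr : (monomial s r : MvPolynomial (Fin n) ℂ) = r • monomial s 1 := by
    rw [smul_monomial, smul_eq_mul, mul_one]
  rw [hr, map_smul, weightInv, h, smul_monomial, smul_monomial, smul_monomial]
  simp [mul_comm]

/-- Dividing monomials by their weights preserves the Fermat ideal. -/
theorem dvd_weightInv {n : ℕ} {m : Fin n → ℕ} (hm : ∀ i, m i ≠ 0) {p : MvPolynomial (Fin n) ℂ}
    (h : ∑ i, X i ^ m i ∣ p) : ∑ i, X i ^ m i ∣ weightInv m p := by
  obtain ⟨q, rfl⟩ := h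
  induction q using MvPolynomial.induction_on' with
  | monomial s r =>
    have : weightInv m ((∑ i, X i ^ m i) * monomial s r) =
        (1 + fermatWeight m s)⁻¹ • ((∑ i, X i ^ m i) * monomial s r) := by
      rw [Finset.sum_mul, map_sum, Finset.smul_sum]
      refine Finset.sum_congr rfl fun i _ => ?_
      rw [X_pow_eq_monomial, monomial_mul, weightInv_monomial, map_add, fermatWeight_single,
        mul_inv_cancel₀ (Nat.cast_ne_zero.2 (hm i))]
    rw [this]
    exact dvd_smul_of_dvd _ (dvd_mul_right _ _)
  | add p q hp hq =>
    rw [mul_add, map_add]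
    exact dvd_add hp hq

theorem linearLift_monomial {n : ℕ} {m : Fin n → ℕ} (hm : ∀ i, m i ≠ 0)
    {a : Matrix (Fin n) (Fin n) ℂ} {c : ℂ} (ha : ∀ i j, m i * a i j = if i = j then c else 0)
    (s : Fin n →₀ ℕ) (r : ℂ) :
    linearLift a (monomial s r) = (c * fermatWeight m s) • monomial s r := by
  have hX : ∀ i, ∑ j, a i j • (X j : MvPolynomial (Fin n) ℂ) = (c * (m i : ℂ)⁻¹) • X i := by
    intro i
    have hi : (m i : ℂ) ≠ 0 := Nat.cast_ne_zero.2 (hm i)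
    rw [Finset.sum_eq_single i]
    · congr 1
      rw [eq_mul_inv_iff_mul_eq₀ hi, mul_comm, ha, if_pos rfl]
    · intro j _ hj
      have := ha i j
      rw [if_neg (Ne.symm hj)] at this
      rw [(mul_eq_zero.1 this).resolve_left hi, zero_smul]
    · simp
  induction s using Finsupp.induction_linear generalizing r with
  | zero => simp [show linearLift a (C r) = 0 from (linearLift a).map_algebraMap r]
  | add s t hs ht =>
    have : (monomial (s + t) r : MvPolynomial (Fin n) ℂ) = monomial s r * monomial t 1 := by
      rw [monomial_mul, mul_one]
    rw [this, Derivation.leibniz, hs, ht, map_add]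
    simp only [smul_eq_mul, MvPolynomial.smul_eq_C_mul, map_mul, map_add]
    ring
  | single i k =>
    have hC : linearLift a (C r) = 0 := (linearLift a).map_algebraMap r
    rw [← C_mul_X_pow_eq_monomial, Derivation.leibniz, hC, smul_zero, add_zero,
      Derivation.leibniz_pow, linearLift, mkDerivation_X, hX, fermatWeight_single]
    cases k with
    | zero => simp
    | succ k =>
      rw [← Nat.cast_smul_eq_nsmul ℂ]
      simp only [smul_eq_mul, MvPolynomial.smul_eq_C_mul, map_mul, Nat.add_sub_cancel]
      ring

/-- Inverting the weights recovers a polynomial, up to its constant term, from its derivative. -/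
theorem weightInv_linearLift {n : ℕ} {m : Fin n → ℕ} (hm : ∀ i, m i ≠ 0)
    {a : Matrix (Fin n) (Fin n) ℂ} {c : ℂ} (ha : ∀ i j, m i * a i j = if i = j then c else 0)
    (p : MvPolynomial (Fin n) ℂ) :
    weightInv m (linearLift a p) = c • (p - C (constantCoeff p)) := by
  induction p using MvPolynomial.induction_on' with
  | monomial s r =>
    rw [linearLift_monomial hm ha, map_smul, weightInv_monomial, smul_smul]
    by_cases hs : s = 0
    · subst hs
      simp
    · have hw : fermatWeight m s ≠ 0 := fun h => hs (fermatWeight_eq_zero hm h)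
      rw [mul_assoc, mul_inv_cancel₀ hw, mul_one, constantCoeff_monomial, if_neg hs]
      simp
  | add p q hp hq =>
    simp only [map_add, hp, hq, ← smul_add]
    congr 1
    ring

/-- A nonzero linear ℂ-derivation of `B_n^m` with all `m_i ≥ 3`
has trivial ring of constants: `ker(d) = ℂ`. -/
theorem linear_derivation_trivial_constants
    (n : ℕ) (hn : 3 ≤ n) (m : Fin n → ℕ) (hm : ∀ i, 3 ≤ m i)
    (d : Derivation ℂ (FermatRing n m) (FermatRing n m)) (hd0 : d ≠ 0)
    (a : Matrix (Fin n) (Fin n) ℂ)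
    (hd : ∀ i, d (fx n m i) = ∑ j, a i j • fx n m j) :
    {f : FermatRing n m | d f = 0} =
      Set.range (algebraMap ℂ (FermatRing n m)) := by
  have hm0 : ∀ i, m i ≠ 0 := fun i => by linarith [hm i]
  have hlift := mk_linearLift d a hd
  obtain ⟨c, hc⟩ := exists_diagonal_of_dvd_linearLift hm a (by
    rw [← Ideal.mem_span_singleton, ← Ideal.Quotient.eq_zero_iff_mem, hlift,
      Ideal.Quotient.eq_zero_iff_mem.2 (Ideal.mem_span_singleton_self _), map_zero])
  have hc0 : c ≠ 0 := by
    rintro rfl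
    refine hd0 (Derivation.ext fun f => ?_)
    obtain ⟨p, rfl⟩ := Ideal.Quotient.mk_surjective f
    have hp : linearLift a p = 0 := by
      induction p using MvPolynomial.induction_on' with
      | monomial s r => rw [linearLift_monomial hm0 hc, zero_mul, zero_smul]
      | add p q hp hq => rw [map_add, hp, hq, add_zero]
    rw [← hlift, hp, map_zero, Derivation.zero_apply]
  ext f
  constructor
  · intro hf
    obtain ⟨p, rfl⟩ := Ideal.Quotient.mk_surjective f
    rw [Set.mem_ofPred_eq, ← hlift, Ideal.Quotient.eq_zero_iff_mem, Ideal.mem_span_singleton] at hf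
    have hdvd := dvd_smul_of_dvd c⁻¹ (dvd_weightInv hm0 hf)
    rw [weightInv_linearLift hm0 hc, smul_smul, inv_mul_cancel₀ hc0, one_smul,
      ← Ideal.mem_span_singleton, ← Ideal.Quotient.eq_zero_iff_mem, map_sub, sub_eq_zero] at hdvd
    exact ⟨constantCoeff p, hdvd.symm⟩
  · rintro ⟨r, rfl⟩
    exact d.map_algebraMap r
end
end

section
/- Let d_α be the nonzero scalar ℂ-derivation of B_n^2 given by d_α(x_i) = α x_i for all i, with α ∈ ℂ nonzero. Then ker(d_α) = ℂ, i.e. the ring of constants of d_α is trivial. -/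
open MvPolynomial

noncomputable section

theorem Derivation.apply_aeval_of_isHomogeneous {σ K A : Type*} [CommRing K] [CommRing A]
    [Algebra K A] (D : Derivation K A A) (α : K) (x : σ → A) (hD : ∀ i, D (x i) = α • x i)
    {k : ℕ} {p : MvPolynomial σ K} (hp : p.IsHomogeneous k) :
    D (aeval x p) = ((k : K) * α) • aeval x p := by
  have hmon (s : σ →₀ ℕ) : D (aeval x (monomial s (1 : K))) =
      ((s.degree : K) * α) • aeval x (monomial s (1 : K)) := by
    induction s using Finsupp.induction_linear with
    | zero => simp
    | add s t hs ht =>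
      have hst : monomial (s + t) (1 : K) = monomial s 1 * monomial t 1 := by
        simp [monomial_mul]
      rw [hst, map_mul, D.leibniz, hs, ht, map_add, Nat.cast_add, add_mul, add_smul]
      simp only [smul_eq_mul, mul_smul_comm]
      rw [mul_comm (aeval x (monomial t (1 : K))), add_comm]
    | single i n =>
      rw [← X_pow_eq_monomial, map_pow, aeval_X, D.leibniz_pow, hD, Finsupp.degree_single]
      cases n with
      | zero => simp
      | succ n =>
        rw [Nat.add_sub_cancel, smul_eq_mul, mul_smul_comm, ← pow_succ, mul_smul,
          Nat.cast_smul_eq_nsmul]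
  rw [p.as_sum, map_sum, map_sum, Finset.smul_sum]
  refine Finset.sum_congr rfl fun s hs => ?_
  have hdeg : s.degree = k := by
    by_contra h
    exact mem_support_iff.mp hs (hp.coeff_eq_zero h)
  have hs : monomial s (p.coeff s) = p.coeff s • monomial s (1 : K) := by
    simp [smul_monomial]
  rw [hs, _root_.map_smul, D.map_smul, hmon, hdeg, smul_comm]

theorem Derivation.apply_aeval_eq_zero_iff {σ K A : Type*} [Field K] [CharZero K] [CommRing A]
    [Algebra K A] (D : Derivation K A A) {α : K} (hα : α ≠ 0) (x : σ → A)
    (hD : ∀ i, D (x i) = α • x i) (p : MvPolynomial σ K) :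
    D (aeval x p) = 0 ↔ aeval x p = algebraMap K A (p.coeff 0) := by
  refine ⟨fun h => ?_, fun h => by rw [h, D.map_algebraMap]⟩
  have hind : iSupIndep fun k : ℕ => Module.End.eigenspace (D : A →ₗ[K] A) ((k : K) * α) :=
    (Module.End.eigenspaces_iSupIndep (D : A →ₗ[K] A)).comp
      fun a b hab => Nat.cast_injective (mul_right_cancel₀ hα hab)
  have hcomp (k : ℕ) : D (aeval x (homogeneousComponent k p)) =
      ((k : K) * α) • aeval x (homogeneousComponent k p) :=
    D.apply_aeval_of_isHomogeneous α x hD (homogeneousComponent_isHomogeneous k p)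
  have hzero := (iSupIndep_iff_finsetSum_eq_zero_imp_eq_zero _).mp hind
    (Finset.range (p.totalDegree + 1))
    (fun k => D (aeval x (homogeneousComponent k p)))
    (fun k _ => by
      rw [hcomp]
      exact Submodule.smul_mem _ _ (Module.End.mem_eigenspace_iff.mpr (hcomp k)))
    (by rw [← map_sum, ← map_sum, sum_homogeneousComponent, h])
  conv_lhs => rw [← sum_homogeneousComponent p]
  rw [map_sum, Finset.sum_eq_single 0]
  · rw [homogeneousComponent_zero, aeval_C]
  · intro k hk hk0
    have hk' := hzero k hk
    simp only [hcomp] at hk'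
    exact (smul_eq_zero.mp hk').resolve_left (mul_ne_zero (Nat.cast_ne_zero.mpr hk0) hα)
  · simp

/-- A nonzero scalar derivation `d_α(x_i) = α x_i` (α ≠ 0) of
`B_n^2` has trivial ring of constants: `ker(d_α) = ℂ`. -/
theorem scalar_derivation_trivial_constants
    (n : ℕ) (hn : 3 ≤ n) (α : ℂ) (hα : α ≠ 0)
    (dα : Derivation ℂ (FermatRing n fun _ => 2) (FermatRing n fun _ => 2))
    (hdα : ∀ i, dα (fx n (fun _ => 2) i) = α • fx n (fun _ => 2) i) :
    {f : FermatRing n fun _ => 2 | dα f = 0} =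
      Set.range (algebraMap ℂ (FermatRing n fun _ => 2)) := by
  ext f
  refine ⟨fun hf => ?_, ?_⟩
  · obtain ⟨p, rfl⟩ := Ideal.Quotient.mk_surjective f
    have hp : Ideal.Quotient.mk _ p = aeval (fx n fun _ => 2) p :=
      DFunLike.congr_fun (aeval_unique (Ideal.Quotient.mkₐ ℂ _)) p
    rw [Set.mem_ofPred_eq, hp, dα.apply_aeval_eq_zero_iff hα _ hdα] at hf
    exact ⟨p.coeff 0, by rw [hp, hf]⟩
  · rintro ⟨c, rfl⟩
    exact dα.map_algebraMap c
end
end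

section
/- Let d_s be a nonzero skew-symmetric linear ℂ-derivation of B_n^2 (its associated matrix B satisfies Bᵀ = −B). Then ker(d_s) ≠ ℂ, i.e. there exists f ∈ B_n^2 with d_s(f) = 0 and f not in the image of ℂ. (Such f can be taken as X B² Xᵀ when B² ≠ 0, and as a linear form a_1x_1+⋯+a_nx_n with (a_1,…,a_n)ᵀ a nonzero kernel vector of Bᵀ when B² = 0.) -/
open MvPolynomial

noncomputable section

/-- The symmetrization of the outer product of two nonzero vectors in dimension at least three is
not a scalar matrix. -/
lemma not_symmetrized_outer_product_eq_scalar {n : ℕ} (hn : 3 ≤ n) {a b : Fin n → ℂ}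
    (ha : a ≠ 0) (hb : b ≠ 0) (c : ℂ)
    (h : ∀ i j, a i * b j + a j * b i = if i = j then 2 * c else 0) : False := by
  have hdiag : ∀ i, a i * b i = c := fun i => by
    have := h i i
    simp only [if_true] at this
    linear_combination this / 2
  have hoff : ∀ i j, i ≠ j → a i * b j + a j * b i = 0 := fun i j hij => by
    simpa [hij] using h i j
  by_cases hc : c = 0
  · obtain ⟨i, hi⟩ := Function.ne_iff.mp ha
    have hi' : a i ≠ 0 := hi
    have hbi : b i = 0 := by simpa [hc, hi'] using hdiag i
    refine hb (funext fun j => ?_)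
    by_cases hij : i = j
    · simpa [← hij] using hbi
    · simpa [hbi, hi'] using hoff i j hij
  · have hsq : ∀ i j, i ≠ j → a i ^ 2 + a j ^ 2 = 0 := fun i j hij => by
      have : c * (a i ^ 2 + a j ^ 2) = 0 := by
        linear_combination a i * a j * hoff i j hij - a i ^ 2 * hdiag j - a j ^ 2 * hdiag i
      simpa [hc] using this
    have h01 := hsq ⟨0, by omega⟩ ⟨1, by omega⟩ (by simp)
    have h02 := hsq ⟨0, by omega⟩ ⟨2, by omega⟩ (by simp)
    have h12 := hsq ⟨1, by omega⟩ ⟨2, by omega⟩ (by simp)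
    have h0 : a ⟨0, by omega⟩ ^ 2 = 0 := by linear_combination (h01 + h02 - h12) / 2
    have h0' : a ⟨0, by omega⟩ = 0 := by simpa using h0
    exact hc (by rw [← hdiag ⟨0, by omega⟩, h0', zero_mul])

lemma pderiv_linear_form {n : ℕ} (a : Fin n → ℂ) (i : Fin n) :
    pderiv i (∑ k, C (a k) * X k : MvPolynomial (Fin n) ℂ) = C (a i) := by
  simp [pderiv_X, Pi.single_apply]

lemma pderiv_sum_sq {n : ℕ} (i : Fin n) :
    pderiv i (∑ k, X k ^ 2 : MvPolynomial (Fin n) ℂ) = C 2 * X i := by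
  simp [pderiv_X, Pi.single_apply, Derivation.leibniz_pow]
  exact (map_ofNat C 2).symm

/-- In at least three variables, a product of two nonzero linear forms is not a constant modulo
`∑ Xᵢ²`. -/
lemma linear_form_mul_ne {n : ℕ} (hn : 3 ≤ n) {a b : Fin n → ℂ} (ha : a ≠ 0) (hb : b ≠ 0)
    (c : ℂ) (p : MvPolynomial (Fin n) ℂ) :
    (∑ k, C (a k) * X k) * (∑ k, C (b k) * X k) ≠ C c + p * ∑ k, X k ^ 2 := by
  intro h
  refine not_symmetrized_outer_product_eq_scalar hn ha hb (eval 0 p) fun i j => ?_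
  have h2 := congrArg (fun f => eval 0 (pderiv i (pderiv j f))) h
  simp only [Derivation.leibniz, map_add, pderiv_linear_form, pderiv_sum_sq, pderiv_C,
    smul_eq_mul, pderiv_X, Pi.single_apply] at h2
  by_cases hij : i = j
  · subst hij
    simp at h2 ⊢
    linear_combination h2
  · simp [hij, Ne.symm hij] at h2 ⊢
    linear_combination h2

/-- A skew-symmetric matrix has left eigenvectors for some pair of opposite eigenvalues. -/
lemma exists_opposite_left_eigenvectors {n : ℕ} (hn : 0 < n) (s : Matrix (Fin n) (Fin n) ℂ)
    (hs : s.transpose = -s) :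
    ∃ (μ : ℂ) (a b : Fin n → ℂ), a ≠ 0 ∧ b ≠ 0 ∧
      Matrix.vecMul a s = μ • a ∧ Matrix.vecMul b s = -μ • b := by
  have : Nonempty (Fin n) := ⟨⟨0, hn⟩⟩
  obtain ⟨μ, hμ⟩ := Module.End.exists_eigenvalue (Matrix.toLin' s)
  obtain ⟨b, hb⟩ := hμ.exists_hasEigenvector
  have hsb : s.mulVec b = μ • b := by simpa using hb.apply_eq_smul
  have hdet : (s - μ • (1 : Matrix (Fin n) (Fin n) ℂ)).det = 0 :=
    Matrix.exists_mulVec_eq_zero_iff.mp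
      ⟨b, hb.2, by simp [Matrix.sub_mulVec, Matrix.smul_mulVec, hsb]⟩
  obtain ⟨a, ha, hsa⟩ := Matrix.exists_vecMul_eq_zero_iff.mpr hdet
  refine ⟨μ, a, b, ha, hb.2, ?_, ?_⟩
  · simpa [Matrix.vecMul_sub, Matrix.vecMul_smul, sub_eq_zero] using hsa
  · rw [← Matrix.mulVec_transpose, hs, Matrix.neg_mulVec, hsb, neg_smul]

/-- A linear derivation sends the linear form with coefficients `a` to the one with coefficients
`a s`; in particular left eigenvectors give eigenforms. -/
lemma derivation_linear_form {n : ℕ} {m : Fin n → ℕ}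
    (d : Derivation ℂ (FermatRing n m) (FermatRing n m)) (s : Matrix (Fin n) (Fin n) ℂ)
    (hd : ∀ i, d (fx n m i) = ∑ j, s i j • fx n m j) {a : Fin n → ℂ} {μ : ℂ}
    (ha : Matrix.vecMul a s = μ • a) :
    d (∑ i, a i • fx n m i) = μ • ∑ i, a i • fx n m i := by
  have ha' : ∀ j, ∑ i, a i * s i j = μ * a j := fun j => congrFun ha j
  simp only [map_sum, Derivation.map_smul, hd, Finset.smul_sum, smul_smul]
  rw [Finset.sum_comm]
  simp only [← Finset.sum_smul, ha']

/-- The product of eigenvectors of a derivation for opposite eigenvalues is a constant. -/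
lemma derivation_mul_eq_zero_of_opposite {A : Type*} [CommRing A] [Algebra ℂ A]
    (d : Derivation ℂ A A) {u v : A} {μ : ℂ} (hu : d u = μ • u) (hv : d v = -μ • v) :
    d (u * v) = 0 := by
  rw [Derivation.leibniz, hu, hv, smul_eq_mul, smul_eq_mul, mul_smul_comm, mul_smul_comm,
    mul_comm v u, neg_smul, neg_add_cancel]

/-- A nonzero skew-symmetric linear derivation of `B_n^2` has a
nontrivial ring of constants: some constant of `d_s` is not in the image of ℂ. -/
theorem skew_derivation_nontrivial_constants
    (n : ℕ) (hn : 3 ≤ n)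
    (ds : Derivation ℂ (FermatRing n fun _ => 2) (FermatRing n fun _ => 2))
    (s : Matrix (Fin n) (Fin n) ℂ) (hs : s.transpose = -s)
    (hds : ∀ i, ds (fx n (fun _ => 2) i) = ∑ j, s i j • fx n (fun _ => 2) j)
    (hne : ds ≠ 0) :
    ∃ f : FermatRing n fun _ => 2, ds f = 0 ∧
      f ∉ Set.range (algebraMap ℂ (FermatRing n fun _ => 2)) := by
  obtain ⟨μ, a, b, ha, hb, hsa, hsb⟩ :=
    exists_opposite_left_eigenvectors (by omega : 0 < n) s hs
  refine ⟨(∑ i, a i • fx n (fun _ => 2) i) * ∑ i, b i • fx n (fun _ => 2) i, ?_, ?_⟩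
  · exact derivation_mul_eq_zero_of_opposite ds (derivation_linear_form ds s hds hsa)
      (derivation_linear_form ds s hds hsb)
  · rintro ⟨c, hc⟩
    have hform : ∀ v : Fin n → ℂ, ∑ i, v i • fx n (fun _ => 2) i =
        Ideal.Quotient.mk (Ideal.span {(∑ i, X i ^ 2 : MvPolynomial (Fin n) ℂ)})
          (∑ i, C (v i) * X i) := fun v => by
      simp only [← smul_eq_C_mul, map_sum]
      rfl
    have hC : algebraMap ℂ (FermatRing n fun _ => 2) c =
        Ideal.Quotient.mk (Ideal.span {(∑ i, X i ^ 2 : MvPolynomial (Fin n) ℂ)}) (C c) := rfl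
    rw [hform, hform, hC, ← map_mul, eq_comm, Ideal.Quotient.eq,
      Ideal.mem_span_singleton'] at hc
    obtain ⟨p, hp⟩ := hc
    exact linear_form_mul_ne hn ha hb c p (by rw [hp]; ring)
end
end

section
/- Let d_s be a nonzero skew-symmetric linear ℂ-derivation of B_n^2. Then there exists α ∈ ℂ such that the derivation d = d_α + d_s, where d_α(x_i) = α x_i for all i, has trivial ring of constants: ker(d) = ℂ. -/
open MvPolynomial

noncomputable section

/-- An endomorphism of a vector space of countable dimension has countably many eigenvalues. -/
theorem countable_setOf_hasEigenvalue {K V : Type} [Field K] [AddCommGroup V] [Module K V]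
    (hV : Module.rank K V ≤ Cardinal.aleph0) (f : Module.End K V) :
    {μ : K | f.HasEigenvalue μ}.Countable := by
  choose v hv using fun μ : {μ : K | f.HasEigenvalue μ} => μ.2.exists_hasEigenvector
  rw [← Cardinal.le_aleph0_iff_set_countable]
  exact (f.eigenvectors_linearIndependent _ v hv).cardinal_le_rank.trans hV

/-- Away from countably many scalars `α`, no `-m α` with `m` a positive integer is an eigenvalue of
a given endomorphism of a vector space of countable dimension. -/
theorem exists_forall_not_hasEigenvalue_neg_mul {V : Type} [AddCommGroup V] [Module ℂ V]
    (hV : Module.rank ℂ V ≤ Cardinal.aleph0) (f : Module.End ℂ V) :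
    ∃ α : ℂ, ∀ m : ℕ, m ≠ 0 → ¬ f.HasEigenvalue (-(m * α)) := by
  by_contra! h
  refine not_countable_complex
    ((Set.countable_iUnion fun m : ℕ =>
      (countable_setOf_hasEigenvalue hV f).image fun μ => -μ / (m : ℂ)).mono fun α _ => ?_)
  obtain ⟨m, hm, hα⟩ := h α
  have : (m : ℂ) ≠ 0 := Nat.cast_ne_zero.mpr hm
  exact Set.mem_iUnion.mpr ⟨m, _, hα, by field_simp⟩

theorem rank_fermatRing_le_aleph0 (n : ℕ) (m : Fin n → ℕ) :
    Module.rank ℂ (FermatRing n m) ≤ Cardinal.aleph0 := by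
  refine (LinearMap.rank_le_of_surjective (Ideal.Quotient.mkₐ ℂ _).toLinearMap
    (Ideal.Quotient.mkₐ_surjective ℂ _)).trans ?_
  rw [MvPolynomial.rank_eq]
  exact Cardinal.mk_le_aleph0

theorem adjoin_range_fx (n : ℕ) (m : Fin n → ℕ) :
    Algebra.adjoin ℂ (Set.range (fx n m)) = ⊤ := by
  have h : Set.range (fx n m) = Ideal.Quotient.mkₐ ℂ _ '' Set.range X := by
    rw [← Set.range_comp]
    rfl
  rw [h, ← AlgHom.map_adjoin, MvPolynomial.adjoin_range_X, Algebra.map_top,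
    AlgHom.range_eq_top]
  exact Ideal.Quotient.mkₐ_surjective ℂ _

/-- The Euler derivation acts on a homogeneous polynomial as multiplication by its degree. -/
theorem MvPolynomial.IsHomogeneous.mkDerivation_X_apply {σ R : Type*} [Fintype σ] [CommRing R]
    {p : MvPolynomial σ R} {k : ℕ} (hp : p.IsHomogeneous k) :
    mkDerivation R (X : σ → MvPolynomial σ R) p = k • p := by
  have happly (q : MvPolynomial σ R) :
      (∑ i, (X i : MvPolynomial σ R) • pderiv i : Derivation R _ (MvPolynomial σ R)) q =
        ∑ i, X i * pderiv i q := by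
    rw [← Derivation.coeFnAddMonoidHom_apply, map_sum, Finset.sum_apply]
    simp
  have h : mkDerivation R (X : σ → MvPolynomial σ R) =
      ∑ i, (X i : MvPolynomial σ R) • pderiv i := by
    classical
    refine derivation_ext fun j => ?_
    simp [happly, pderiv_X, Pi.single_apply]
  rw [h, happly, hp.sum_X_mul_pderiv]

/-- The Euler derivation of the polynomial ring descends to the Fermat ring `B_n^k`. -/
theorem exists_euler_derivation (n k : ℕ) :
    ∃ E : Derivation ℂ (FermatRing n fun _ => k) (FermatRing n fun _ => k),
      ∀ p : MvPolynomial (Fin n) ℂ, E (Ideal.Quotient.mkₐ ℂ _ p) =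
        Ideal.Quotient.mkₐ ℂ _ (mkDerivation ℂ X p) := by
  have hF : (∑ i, X i ^ k : MvPolynomial (Fin n) ℂ).IsHomogeneous k :=
    IsHomogeneous.sum _ _ _ fun i _ => isHomogeneous_X_pow i k
  refine ⟨Derivation.liftOfSurjective
    (f := Ideal.Quotient.mkₐ ℂ (Ideal.span {(∑ i, X i ^ k : MvPolynomial (Fin n) ℂ)}))
    (Ideal.Quotient.mkₐ_surjective ℂ _) (d := mkDerivation ℂ X) fun p hp => ?_,
    Derivation.liftOfSurjective_apply _ _⟩
  rw [Ideal.Quotient.mkₐ_eq_mk, Ideal.Quotient.eq_zero_iff_mem] at hp ⊢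
  obtain ⟨q, rfl⟩ := Ideal.mem_span_singleton.mp hp
  rw [Derivation.leibniz, hF.mkDerivation_X_apply]
  have hF_mem := Ideal.mem_span_singleton_self (∑ i, X i ^ k : MvPolynomial (Fin n) ℂ)
  exact add_mem (Ideal.mul_mem_right _ _ hF_mem) (Ideal.mul_mem_left _ _ (nsmul_mem hF_mem _))

/-- A linear derivation commutes with the Euler derivation. -/
theorem euler_commute_of_linear {n : ℕ} {m : Fin n → ℕ}
    {E D : Derivation ℂ (FermatRing n m) (FermatRing n m)} (s : Matrix (Fin n) (Fin n) ℂ)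
    (hE : ∀ i, E (fx n m i) = fx n m i)
    (hD : ∀ i, D (fx n m i) = ∑ j, s i j • fx n m j) (f : FermatRing n m) :
    E (D f) = D (E f) := by
  have h : ⁅E, D⁆ = 0 := by
    refine Derivation.ext_of_adjoin_eq_top _ (adjoin_range_fx n m) ?_
    rintro _ ⟨i, rfl⟩
    simp [Derivation.commutator_apply, hE, hD]
  simpa [Derivation.commutator_apply, sub_eq_zero] using DFunLike.congr_fun h f

/-- For every nonzero skew-symmetric linear derivation `d_s` of
`B_n^2` there is a scalar derivation `d_α` (given by `d_α(x_i) = α x_i`) such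
that `d = d_α + d_s` has trivial ring of constants. -/
theorem exists_scalar_making_constants_trivial
    (n : ℕ) (hn : 3 ≤ n)
    (ds : Derivation ℂ (FermatRing n fun _ => 2) (FermatRing n fun _ => 2))
    (s : Matrix (Fin n) (Fin n) ℂ) (hs : s.transpose = -s)
    (hds : ∀ i, ds (fx n (fun _ => 2) i) = ∑ j, s i j • fx n (fun _ => 2) j)
    (hne : ds ≠ 0) :
    ∃ α : ℂ,
      ∃ dα : Derivation ℂ (FermatRing n fun _ => 2) (FermatRing n fun _ => 2),
        (∀ i, dα (fx n (fun _ => 2) i) = α • fx n (fun _ => 2) i) ∧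
        {f : FermatRing n fun _ => 2 | (dα + ds) f = 0} =
          Set.range (algebraMap ℂ (FermatRing n fun _ => 2)) := by
  set π := Ideal.Quotient.mkₐ ℂ (Ideal.span {(∑ i, X i ^ 2 : MvPolynomial (Fin n) ℂ)}) with hπ
  obtain ⟨E, hE⟩ := exists_euler_derivation n 2
  have hEx (i : Fin n) : E (fx n (fun _ => 2) i) = fx n (fun _ => 2) i := by
    exact (hE (X i)).trans (by rw [mkDerivation_X]; rfl)
  have hcomm := euler_commute_of_linear s hEx hds
  obtain ⟨α, hα⟩ := exists_forall_not_hasEigenvalue_neg_mul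
    (rank_fermatRing_le_aleph0 n fun _ => 2) (ds : Module.End ℂ (FermatRing n fun _ => 2))
  refine ⟨α, α • E, fun i => by rw [Derivation.smul_apply, hEx], Set.Subset.antisymm ?_ ?_⟩
  · intro f hf
    obtain ⟨p, rfl⟩ := Ideal.Quotient.mkₐ_surjective ℂ _ f
    have hEc (k : ℕ) : E (π (homogeneousComponent k p)) =
        (k : ℂ) • π (homogeneousComponent k p) := by
      rw [hπ, hE, (homogeneousComponent_isHomogeneous k p).mkDerivation_X_apply, map_nsmul,
        Nat.cast_smul_eq_nsmul]
    have hsum : ∑ k ∈ Finset.range (p.totalDegree + 1),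
        (α • E + ds) (π (homogeneousComponent k p)) = 0 := by
      rw [← map_sum, ← map_sum, sum_homogeneousComponent]
      exact hf
    have hindep := (Module.End.eigenspaces_iSupIndep
      (E : Module.End ℂ (FermatRing n fun _ => 2))).comp (Nat.cast_injective (R := ℂ))
    have hzero := (iSupIndep_iff_finsetSum_eq_zero_imp_eq_zero _).mp hindep _ _
      (fun k _ => ?_) hsum
    · have hcomp (k : ℕ) (hk : k ∈ Finset.range (p.totalDegree + 1)) (hk0 : k ≠ 0) :
          π (homogeneousComponent k p) = 0 := by
        by_contra hne0
        refine hα k hk0 (Module.End.hasEigenvalue_of_hasEigenvector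
          (x := π (homogeneousComponent k p)) ⟨Module.End.mem_eigenspace_iff.mpr ?_, hne0⟩)
        have h0 := hzero k hk
        rw [Derivation.add_apply, Derivation.smul_apply, hEc] at h0
        rw [Derivation.coeFn_coe, eq_neg_of_add_eq_zero_right h0, smul_smul, mul_comm, neg_smul]
      refine ⟨coeff 0 p, ?_⟩
      conv_rhs => rw [← sum_homogeneousComponent p, map_sum]
      rw [Finset.sum_eq_single_of_mem 0 (by simp) fun k hk hk0 => hcomp k hk hk0,
        homogeneousComponent_zero]
      rfl
    · refine Module.End.mem_eigenspace_iff.mpr ?_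
      rw [Derivation.coeFn_coe, Derivation.add_apply, Derivation.smul_apply, map_add, hcomm,
        hEc, Derivation.map_smul, Derivation.map_smul, Derivation.map_smul, hEc, smul_add,
        smul_comm α]
  · rintro _ ⟨c, rfl⟩
    exact Derivation.map_algebraMap _ c
end
end

section
/- Let d be the linear ℂ-derivation of B_3^2 = ℂ[x,y,z] (with x²+y²+z² = 0) defined by d(x) = x, d(y) = y − z, d(z) = y + z. Then ker(d) = ℂ. -/
open MvPolynomial

noncomputable section

/-- If a `ℂ`-algebra is generated by eigenvectors of a derivation whose eigenvalues have positive
real part, then the only constants of the derivation are the scalars. -/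
theorem Derivation.mem_range_algebraMap_of_eigenvectors {A : Type*} [CommRing A] [Algebra ℂ A]
    (D : Derivation ℂ A A) {f : A}
    (hf : f ∈ Algebra.adjoin ℂ {a : A | ∃ μ : ℂ, 0 < μ.re ∧ D a = μ • a}) (hD : D f = 0) :
    f ∈ Set.range (algebraMap ℂ A) := by
  set E : Set A := {a : A | ∃ μ : ℂ, 0 < μ.re ∧ D a = μ • a}
  let S : Submodule ℂ A := ⨆ (μ : ℂ) (_ : μ ≠ 0), Module.End.eigenspace (D : A →ₗ[ℂ] A) μ
  have closure_le : ∀ a ∈ Submonoid.closure E, a = 1 ∨ a ∈ E := by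
    intro a ha
    induction ha using Submonoid.closure_induction with
    | mem a ha => exact Or.inr ha
    | one => exact Or.inl rfl
    | mul a b _ _ ha hb =>
      rcases ha with rfl | ⟨μ, hμ, ha⟩
      · simpa using hb
      rcases hb with rfl | ⟨ν, hν, hb⟩
      · exact Or.inr ⟨μ, hμ, by simpa using ha⟩
      · refine Or.inr ⟨μ + ν, by simpa using add_pos hμ hν, ?_⟩
        rw [D.leibniz, ha, hb, smul_eq_mul, smul_eq_mul, add_smul, mul_smul_comm, mul_smul_comm,
          mul_comm b a, add_comm]
  have hspan : f ∈ LinearMap.range (Algebra.linearMap ℂ A) ⊔ S := by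
    rw [← Subalgebra.mem_toSubmodule, Algebra.adjoin_eq_span] at hf
    refine Submodule.span_le.2 (fun a ha => ?_) hf
    rcases closure_le a ha with rfl | ⟨μ, hμ, ha⟩
    · exact Submodule.mem_sup_left ⟨1, by simp⟩
    · have hμ0 : μ ≠ 0 := by
        rintro rfl
        simp at hμ
      exact Submodule.mem_sup_right
        (Submodule.mem_iSup_of_mem μ (Submodule.mem_iSup_of_mem hμ0
          (Module.End.mem_eigenspace_iff.2 ha)))
  obtain ⟨_, ⟨c, rfl⟩, s, hs, rfl⟩ := Submodule.mem_sup.1 hspan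
  have hs0 : s ∈ Module.End.eigenspace (D : A →ₗ[ℂ] A) 0 := by
    rw [Module.End.mem_eigenspace_iff]
    simpa using hD
  have : s = 0 := Submodule.disjoint_def.1
    (Module.End.eigenspaces_iSupIndep (D : A →ₗ[ℂ] A) 0) s hs0 hs
  exact ⟨c, by simp [this]⟩

/-- The linear derivation of `B_3^2 = ℂ[x,y,z]`
(`x²+y²+z² = 0`) given by `d(x) = x`, `d(y) = y − z`, `d(z) = y + z` has trivial
ring of constants: `ker(d) = ℂ`. -/
theorem example_derivation_trivial_constants
    (d : Derivation ℂ (FermatRing 3 fun _ => 2) (FermatRing 3 fun _ => 2))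
    (h0 : d (fx 3 (fun _ => 2) 0) = fx 3 (fun _ => 2) 0)
    (h1 : d (fx 3 (fun _ => 2) 1) = fx 3 (fun _ => 2) 1 - fx 3 (fun _ => 2) 2)
    (h2 : d (fx 3 (fun _ => 2) 2) = fx 3 (fun _ => 2) 1 + fx 3 (fun _ => 2) 2) :
    {f : FermatRing 3 fun _ => 2 | d f = 0} =
      Set.range (algebraMap ℂ (FermatRing 3 fun _ => 2)) := by
  ext f
  refine ⟨fun hf => d.mem_range_algebraMap_of_eigenvectors ?_ hf, ?_⟩
  · set E := {a | ∃ μ : ℂ, 0 < μ.re ∧ d a = μ • a}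
    set x := fx 3 (fun _ => 2) 0
    set y := fx 3 (fun _ => 2) 1
    set z := fx 3 (fun _ => 2) 2
    have hI : Complex.I * Complex.I = -1 := Complex.I_mul_I
    have hx : x ∈ Algebra.adjoin ℂ E := Algebra.subset_adjoin ⟨1, by simp, by simpa using h0⟩
    have hu : y + Complex.I • z ∈ Algebra.adjoin ℂ E := by
      refine Algebra.subset_adjoin ⟨1 + Complex.I, by simp, ?_⟩
      rw [map_add, d.map_smul, h1, h2]
      linear_combination (norm := module) -hI • z
    have hv : y - Complex.I • z ∈ Algebra.adjoin ℂ E := by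
      refine Algebra.subset_adjoin ⟨1 - Complex.I, by simp, ?_⟩
      rw [map_sub, d.map_smul, h1, h2]
      linear_combination (norm := module) -hI • z
    have hy' : y ∈ Algebra.adjoin ℂ E := by
      have h := Subalgebra.smul_mem _ (add_mem hu hv) (1 / 2 : ℂ)
      convert h using 1
      module
    have hz' : z ∈ Algebra.adjoin ℂ E := by
      have h := Subalgebra.smul_mem _ (sub_mem hu hv) (-Complex.I / 2)
      convert h using 1
      linear_combination (norm := module) hI • z
    have htop : (⊤ : Subalgebra ℂ (FermatRing 3 fun _ => 2)) ≤ Algebra.adjoin ℂ E := by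
      rw [← adjoin_range_fx, Algebra.adjoin_le_iff]
      rintro _ ⟨i, rfl⟩
      fin_cases i
      exacts [hx, hy', hz']
    exact htop Algebra.mem_top
  · rintro ⟨c, rfl⟩
    exact d.map_algebraMap c
end
end
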